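/- arXiv:math/0605619 — 3 statements merged into one kernel-verified Lean document; each statement's English description precedes it below -/
import Mathlib

section
/- Assume (H1)–(H3), let λ̄ be the ergodic constant and, for α > 0, let w^α be the unique continuous space-time periodic viscosity solution of w^α_t + G(x,y,t,D_x w^α, D_y w^α) + α w^α = 0 on ℝⁿ×ℝ×ℝ. Then for every δ > 0 there exists α₀ > 0 such that for all 0 < α < α₀, w^α is a viscosity subsolution of w_t + G(x,y,t,D_x w, D_y w) = λ̄ + δ and a viscosity supersolution of w_t + G(x,y,t,D_x w, D_y w) = λ̄ − δ on ℝⁿ×ℝ×ℝ. -/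
open MeasureTheory Topology Filter
open scoped RealInnerProductSpace

noncomputable section

/-- Euclidean space ℝⁿ. -/
abbrev Euc (n : ℕ) := EuclideanSpace ℝ (Fin n)

/-- Hamiltonians G = G(x, y, t, p_x, p_y). -/
abbrev Ham (n : ℕ) := Euc n → ℝ → ℝ → Euc n → ℝ → ℝ

/-- The space of points (x, y, t) ∈ ℝⁿ×ℝ×ℝ. -/
abbrev Dom (n : ℕ) := Euc n × ℝ × ℝ

/-- The space of points ξ = (x, y, t, p_x, p_y). -/
abbrev Xi (n : ℕ) := Euc n × ℝ × ℝ × Euc n × ℝ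

/-- The space of points (x, t) ∈ ℝⁿ×ℝ. -/
abbrev Dom2 (n : ℕ) := Euc n × ℝ

/-- The integer vector k viewed as a point of ℝⁿ. -/
def intVec {n : ℕ} (k : Fin n → ℤ) : Euc n := WithLp.toLp 2 (fun i => (k i : ℝ))

/-- ∂φ/∂t for φ = φ(x,y,t). -/
def pdT {n : ℕ} (φ : Dom n → ℝ) (z : Dom n) : ℝ := fderiv ℝ φ z (0, 0, 1)

/-- ∂φ/∂y for φ = φ(x,y,t). -/
def pdY {n : ℕ} (φ : Dom n → ℝ) (z : Dom n) : ℝ := fderiv ℝ φ z (0, 1, 0)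

/-- D_x φ for φ = φ(x,y,t). -/
def pdX {n : ℕ} (φ : Dom n → ℝ) (z : Dom n) : Euc n :=
  WithLp.toLp 2 (fun i => fderiv ℝ φ z (EuclideanSpace.single i 1, 0, 0))

/-- ∂φ/∂t for φ = φ(x,t). -/
def pdT2 {n : ℕ} (φ : Dom2 n → ℝ) (z : Dom2 n) : ℝ := fderiv ℝ φ z (0, 1)

/-- D_x φ for φ = φ(x,t). -/
def pdX2 {n : ℕ} (φ : Dom2 n → ℝ) (z : Dom2 n) : Euc n :=
  WithLp.toLp 2 (fun i => fderiv ℝ φ z (EuclideanSpace.single i 1, 0))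

/-- Viscosity subsolution of `w_t + G(x,y,t,D_x w,D_y w) + α w = λ` on ℝⁿ×ℝ×ℝ. -/
def ViscSub {n : ℕ} (G : Ham n) (α lam : ℝ) (u : Dom n → ℝ) : Prop :=
  UpperSemicontinuous u ∧
  ∀ φ : Dom n → ℝ, ContDiff ℝ 1 φ → ∀ z : Dom n,
    IsLocalMax (fun w => u w - φ w) z →
    pdT φ z + G z.1 z.2.1 z.2.2 (pdX φ z) (pdY φ z) + α * u z ≤ lam

/-- Viscosity supersolution of `w_t + G(x,y,t,D_x w,D_y w) + α w = λ` on ℝⁿ×ℝ×ℝ. -/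
def ViscSuper {n : ℕ} (G : Ham n) (α lam : ℝ) (u : Dom n → ℝ) : Prop :=
  LowerSemicontinuous u ∧
  ∀ φ : Dom n → ℝ, ContDiff ℝ 1 φ → ∀ z : Dom n,
    IsLocalMin (fun w => u w - φ w) z →
    lam ≤ pdT φ z + G z.1 z.2.1 z.2.2 (pdX φ z) (pdY φ z) + α * u z

/-- Viscosity solution of `w_t + G(x,y,t,D_x w,D_y w) + α w = λ` on ℝⁿ×ℝ×ℝ. -/
def ViscSol {n : ℕ} (G : Ham n) (α lam : ℝ) (u : Dom n → ℝ) : Prop :=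
  Continuous u ∧ ViscSub G α lam u ∧ ViscSuper G α lam u

/-- ℤⁿ-periodicity in x, 1-periodicity in y and t. -/
def STPeriodic {n : ℕ} (u : Dom n → ℝ) : Prop :=
  (∀ (k : Fin n → ℤ) (x : Euc n) (y t : ℝ), u (x + intVec k, y, t) = u (x, y, t)) ∧
  (∀ x y t, u (x, y + 1, t) = u (x, y, t)) ∧
  (∀ x y t, u (x, y, t + 1) = u (x, y, t))

/-- Boundedness of a function on ℝⁿ×ℝ×ℝ. -/
def Bdd {n : ℕ} (u : Dom n → ℝ) : Prop := ∃ M, ∀ z, |u z| ≤ M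

/-- (H1) : continuity and periodicity of the Hamiltonian. -/
def HypH1 {n : ℕ} (G : Ham n) : Prop :=
  Continuous (fun ξ : Xi n => G ξ.1 ξ.2.1 ξ.2.2.1 ξ.2.2.2.1 ξ.2.2.2.2) ∧
  (∀ (k : Fin n → ℤ) x y t px py, G (x + intVec k) y t px py = G x y t px py) ∧
  (∀ x y t px py, G x (y + 1) t px py = G x y t px py) ∧
  (∀ x y t px py, G x y (t + 1) px py = G x y t px py)

/-- (H2) : coercivity in p_x at p_y = 0, with constants C₁, C₂ > 0. -/
def HypH2 {n : ℕ} (G : Ham n) (C₁ C₂ : ℝ) : Prop :=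
  0 < C₁ ∧ 0 < C₂ ∧ ∀ x y t px, C₁ * ‖px‖ - C₂ ≤ G x y t px 0

/-- (H2') : coercivity in p_x, locally uniformly in p_y. -/
def HypH2' {n : ℕ} (F : Ham n) : Prop :=
  ∀ R : ℝ, 0 < R → ∃ C₁ C₂ : ℝ, 0 < C₁ ∧ 0 < C₂ ∧
    ∀ x y t px py, |py| ≤ R → C₁ * ‖px‖ - C₂ ≤ F x y t px py

/-- (H3) : local Lipschitz continuity in (y,t,p_y) and a.e. bounds on the
partial derivatives ∂_y G, ∂_t G, ∂_{p_y} G. -/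
def HypH3 {n : ℕ} (G : Ham n) (l C₃ C₄ C₅ : ℝ) : Prop :=
  0 ≤ C₃ ∧ 0 ≤ C₄ ∧ 0 ≤ C₅ ∧
  (∀ (x px : Euc n), LocallyLipschitz (fun q : ℝ × ℝ × ℝ => G x q.1 q.2.1 px q.2.2)) ∧
  (∀ᵐ ξ ∂(volume : Measure (Xi n)),
    |deriv (fun y => G ξ.1 y ξ.2.2.1 ξ.2.2.2.1 ξ.2.2.2.2) ξ.2.1| ≤ C₃ * |ξ.2.2.2.2 + l| ∧
    |deriv (fun t => G ξ.1 ξ.2.1 t ξ.2.2.2.1 ξ.2.2.2.2) ξ.2.2.1| ≤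
      C₄ * (1 + |ξ.2.2.2.2| + |G ξ.1 ξ.2.1 ξ.2.2.1 ξ.2.2.2.1 ξ.2.2.2.2|) ∧
    |deriv (fun py => G ξ.1 ξ.2.1 ξ.2.2.1 ξ.2.2.2.1 py) ξ.2.2.2.2| ≤ C₅)

/-- λ is an ergodic constant : bounded usc subsolution and bounded lsc
supersolution of `w_t + G = λ` exist. -/
def ErgodicConst {n : ℕ} (G : Ham n) (lam : ℝ) : Prop :=
  (∃ u, Bdd u ∧ ViscSub G 0 lam u) ∧ (∃ v, Bdd v ∧ ViscSuper G 0 lam v)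

/-- λ solves the cell problem at (p_x,p_y) : the equation
`v_t + F(x,y,t,p_x + D_x v, p_y + D_y v) = λ` has a bounded space-time periodic
usc subsolution and a bounded space-time periodic lsc supersolution. -/
def CellOk {n : ℕ} (F : Ham n) (px : Euc n) (py lam : ℝ) : Prop :=
  (∃ u, Bdd u ∧ STPeriodic u ∧
    ViscSub (fun x y t qx qy => F x y t (px + qx) (py + qy)) 0 lam u) ∧
  (∃ v, Bdd v ∧ STPeriodic v ∧
    ViscSuper (fun x y t qx qy => F x y t (px + qx) (py + qy)) 0 lam v)

/-- Viscosity subsolution of `w_t + G(x,y,t,D_x w,D_y w) = 0` on ℝⁿ×ℝ×(0,∞). -/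
def ViscSubPos {n : ℕ} (G : Ham n) (u : Dom n → ℝ) : Prop :=
  ∀ φ : Dom n → ℝ, ContDiff ℝ 1 φ → ∀ z : Dom n, 0 < z.2.2 →
    IsLocalMax (fun w => u w - φ w) z →
    pdT φ z + G z.1 z.2.1 z.2.2 (pdX φ z) (pdY φ z) ≤ 0

/-- Viscosity supersolution of `w_t + G(x,y,t,D_x w,D_y w) = 0` on ℝⁿ×ℝ×(0,∞). -/
def ViscSuperPos {n : ℕ} (G : Ham n) (u : Dom n → ℝ) : Prop :=
  ∀ φ : Dom n → ℝ, ContDiff ℝ 1 φ → ∀ z : Dom n, 0 < z.2.2 →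
    IsLocalMin (fun w => u w - φ w) z →
    0 ≤ pdT φ z + G z.1 z.2.1 z.2.2 (pdX φ z) (pdY φ z)

/-- Bounded uniformly continuous (on every slab ℝⁿ×ℝ×[0,T]) viscosity solution of the
initial value problem `v_t + G(x,y,t,D_x v,D_y v) = 0` on ℝⁿ×ℝ×(0,∞), `v(x,y,0) = v₀(x,y)`. -/
def IVPSol {n : ℕ} (G : Ham n) (v₀ : Dom2 n → ℝ) (v : Dom n → ℝ) : Prop :=
  ContinuousOn v {z : Dom n | 0 ≤ z.2.2} ∧
  (∀ x y, v (x, y, 0) = v₀ (x, y)) ∧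
  ViscSubPos G v ∧ ViscSuperPos G v ∧
  (∀ T : ℝ, 0 < T →
    (∃ M, ∀ z : Dom n, 0 ≤ z.2.2 → z.2.2 ≤ T → |v z| ≤ M) ∧
    UniformContinuousOn v {z : Dom n | 0 ≤ z.2.2 ∧ z.2.2 ≤ T})

/-- Viscosity subsolution of the eikonal-type inequality `w_t + c|D_x w| - C ≤ 0` on ℝⁿ×ℝ. -/
def ViscSubEik {n : ℕ} (c C : ℝ) (u : Dom2 n → ℝ) : Prop :=
  UpperSemicontinuous u ∧
  ∀ φ : Dom2 n → ℝ, ContDiff ℝ 1 φ → ∀ z : Dom2 n,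
    IsLocalMax (fun w => u w - φ w) z →
    pdT2 φ z + c * ‖pdX2 φ z‖ - C ≤ 0

/-- Mean value inequality for locally Lipschitz functions with an a.e. derivative bound. -/
lemma aux_mvt {f : ℝ → ℝ} (hf : LocallyLipschitz f) {a b C : ℝ}
    (h : ∀ᵐ x ∂(volume : Measure ℝ), x ∈ Set.uIcc a b → |deriv f x| ≤ C) :
    |f b - f a| ≤ C * |b - a| := by
  obtain ⟨K, hK⟩ := (hf.locallyLipschitzOn (s := Set.uIcc a b)).exists_lipschitzOnWith_of_compact
    isCompact_uIcc
  have hac := hK.absolutelyContinuousOnInterval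
  rw [← hac.integral_deriv_eq_sub]
  have := intervalIntegral.norm_integral_le_of_norm_le_const_ae (f := deriv f) (a := a) (b := b)
    (C := C) (by
      filter_upwards [h] with x hx hx2
      exact hx (Set.uIoc_subset_uIcc hx2))
  simpa using this

/-- A Gronwall type inequality on short intervals. -/
lemma aux_gron {f : ℝ → ℝ} (hf : LocallyLipschitz f) {C K : ℝ} (hC : 0 ≤ C)
    (h : ∀ᵐ x ∂(volume : Measure ℝ), |deriv f x| ≤ C * (K + |f x|)) {s t : ℝ}
    (hst : C * |t - s| ≤ 1 / 2) :
    |f t - f s| ≤ 2 * C * |t - s| * (K + |f s|) := by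
  have hcont : Continuous f := hf.continuous
  obtain ⟨r, hr, hmax⟩ := (isCompact_uIcc (a := s) (b := t)).exists_isMaxOn
    ⟨s, Set.left_mem_uIcc⟩ (hcont.abs.continuousOn)
  have hm : ∀ x ∈ Set.uIcc s t, |f x| ≤ |f r| := fun x hx => hmax hx
  have key : ∀ x ∈ Set.uIcc s t, |f x - f s| ≤ C * (K + |f r|) * |t - s| := by
    intro x hx
    have hsub : Set.uIcc s x ⊆ Set.uIcc s t := Set.uIcc_subset_uIcc Set.left_mem_uIcc hx
    have h1 : |f x - f s| ≤ C * (K + |f r|) * |x - s| := by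
      apply aux_mvt hf
      filter_upwards [h] with y hy hy2
      refine hy.trans ?_
      have := hm y (hsub hy2)
      gcongr
    by_cases hneg : 0 ≤ C * (K + |f r|)
    · refine h1.trans ?_
      have : |x - s| ≤ |t - s| := Set.abs_sub_left_of_mem_uIcc hx
      gcongr
    · exfalso
      push Not at hneg
      obtain ⟨y, hy, hy2⟩ : ∃ y, |deriv f y| ≤ C * (K + |f y|) ∧ y ∈ Set.univ := by
        obtain ⟨y, hy⟩ := h.exists
        exact ⟨y, hy, trivial⟩
      by_cases hst0 : s = t
      · subst hst0
        simp only [Set.uIcc_self, Set.mem_singleton_iff] at hr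
        subst hr
        have hd := Measure.dense_of_ae h
        have hcl : ∀ᵐ x ∂(volume : Measure ℝ), 0 ≤ C * (K + |f x|) := by
          filter_upwards [h] with x hx using (abs_nonneg _).trans hx
        have hd := Measure.dense_of_ae hcl
        have hc : IsClosed {x | 0 ≤ C * (K + |f x|)} :=
          isClosed_le continuous_const (by fun_prop)
        have := hc.closure_eq ▸ hd.closure_eq
        have h3 : r ∈ {x | 0 ≤ C * (K + |f x|)} := by rw [this]; trivial
        exact absurd h3 (not_le.mpr hneg)
      · have hcl : ∀ᵐ x ∂(volume : Measure ℝ), 0 ≤ C * (K + |f x|) := by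
          filter_upwards [h] with x hx using (abs_nonneg _).trans hx
        have hd := Measure.dense_of_ae hcl
        have hc : IsClosed {x | 0 ≤ C * (K + |f x|)} :=
          isClosed_le continuous_const (by fun_prop)
        have := hc.closure_eq ▸ hd.closure_eq
        have h3 : r ∈ {x | 0 ≤ C * (K + |f x|)} := by rw [this]; trivial
        exact absurd h3 (not_le.mpr hneg)
  have h1 := key r hr
  have h2 := key t Set.right_mem_uIcc
  have h3 : |f r| ≤ |f r - f s| + |f s| := by
    have := abs_add_le (f r - f s) (f s); simpa using this
  have hE : C * (K + |f r|) * |t - s| = (C * |t - s|) * (K + |f r|) := by ring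
  rw [hE] at h1 h2
  have hp : 0 ≤ C * |t - s| := by positivity
  by_cases hpos : 0 ≤ K + |f r|
  · have h4 : K + |f r| ≤ 2 * (K + |f s|) := by
      have : (C * |t - s|) * (K + |f r|) ≤ 1 / 2 * (K + |f r|) := by gcongr
      linarith
    calc |f t - f s| ≤ (C * |t - s|) * (K + |f r|) := h2
      _ ≤ (C * |t - s|) * (2 * (K + |f s|)) := by gcongr
      _ = _ := by ring
  · have h5 : |f s| ≤ |f r| := hm s Set.left_mem_uIcc
    have h6 : |f r - f s| ≤ 0 := h1.trans (by nlinarith)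
    have h7 : f r = f s := by
      have := abs_nonpos_iff.mp h6; linarith
    have h8 := abs_nonneg (f t - f s)
    rw [h7] at h2 hpos
    push Not at hpos
    have : (C * |t - s|) * (K + |f s|) = 0 := le_antisymm (by nlinarith) (h8.trans h2)
    nlinarith

/-- An almost everywhere true closed condition holds everywhere. -/
lemma aux_closed {X : Type*} [TopologicalSpace X] [MeasurableSpace X] {μ : Measure X}
    [μ.IsOpenPosMeasure] {p : X → Prop} (h : ∀ᵐ x ∂μ, p x) (hc : IsClosed {x | p x}) (x : X) :
    p x := by
  have hd := (Measure.dense_of_ae h).closure_eq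
  rw [hc.closure_eq] at hd
  have : x ∈ {x | p x} := by rw [hd]; trivial
  exact this

lemma aux_swap {X Y : Type*} [MeasureSpace X] [MeasureSpace Y]
    [SFinite (volume : Measure X)] [SFinite (volume : Measure Y)] {p : X × Y → Prop}
    (h : ∀ᵐ z ∂(volume : Measure (X × Y)), p z) :
    ∀ᵐ y ∂(volume : Measure Y), ∀ᵐ x ∂(volume : Measure X), p (x, y) := by
  have h1 : ∀ᵐ z ∂(volume : Measure (Y × X)), p z.swap :=
    (Measure.measurePreserving_swap (μ := (volume : Measure Y))
      (ν := (volume : Measure X))).quasiMeasurePreserving.ae h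
  exact Measure.ae_ae_of_ae_prod h1

lemma aux_nest {X Y : Type*} [MeasureSpace X] [MeasureSpace Y]
    [SFinite (volume : Measure X)] [SFinite (volume : Measure Y)] {p : X × Y → Prop}
    (h : ∀ᵐ z ∂(volume : Measure (X × Y)), p z) :
    ∀ᵐ x ∂(volume : Measure X), ∀ᵐ y ∂(volume : Measure Y), p (x, y) :=
  Measure.ae_ae_of_ae_prod h

section HamEst
variable {n : ℕ} {G : Ham n} {l C₃ C₄ C₅ : ℝ}

lemma G_lip_py (h1 : HypH1 G) (h3 : HypH3 G l C₃ C₄ C₅) (x : Euc n) (y t : ℝ) (px : Euc n)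
    (q q' : ℝ) : |G x y t px q - G x y t px q'| ≤ C₅ * |q - q'| := by
  obtain ⟨_, _, _, hL, hae⟩ := h3
  have hG := h1.1
  have hae' : ∀ᵐ ξ ∂(volume : Measure (Xi n)),
    |deriv (fun py => G ξ.1 ξ.2.1 ξ.2.2.1 ξ.2.2.2.1 py) ξ.2.2.2.2| ≤ C₅ := by
    filter_upwards [hae] with ξ h using h.2.2
  have hcont : Continuous (fun ξ : Xi n => |G ξ.1 ξ.2.1 ξ.2.2.1 ξ.2.2.2.1 q -
      G ξ.1 ξ.2.1 ξ.2.2.1 ξ.2.2.2.1 q'|) := by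
    refine Continuous.abs (Continuous.sub ?_ ?_)
    · exact hG.comp (f := fun ξ : Xi n => ((ξ.1, ξ.2.1, ξ.2.2.1, ξ.2.2.2.1, q) : Xi n))
        (by fun_prop)
    · exact hG.comp (f := fun ξ : Xi n => ((ξ.1, ξ.2.1, ξ.2.2.1, ξ.2.2.2.1, q') : Xi n))
        (by fun_prop)
  have A1 := aux_nest hae'
  refine aux_closed (p := fun x => |G x y t px q - G x y t px q'| ≤ C₅ * |q - q'|)
    (μ := volume) ?_ ?_ x
  swap
  · exact isClosed_le (hcont.comp (f := fun x => ((x, y, t, px, 0) : Xi n)) (by fun_prop))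
      continuous_const
  filter_upwards [A1] with x hx
  refine aux_closed (p := fun y => |G x y t px q - G x y t px q'| ≤ C₅ * |q - q'|)
    (μ := volume) ?_ ?_ y
  swap
  · exact isClosed_le (hcont.comp (f := fun y => ((x, y, t, px, 0) : Xi n)) (by fun_prop))
      continuous_const
  filter_upwards [aux_nest hx] with y hy
  refine aux_closed (p := fun t => |G x y t px q - G x y t px q'| ≤ C₅ * |q - q'|)
    (μ := volume) ?_ ?_ t
  swap
  · exact isClosed_le (hcont.comp (f := fun t => ((x, y, t, px, 0) : Xi n)) (by fun_prop))
      continuous_const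
  filter_upwards [aux_nest hy] with t ht
  refine aux_closed (p := fun px => |G x y t px q - G x y t px q'| ≤ C₅ * |q - q'|)
    (μ := volume) ?_ ?_ px
  swap
  · exact isClosed_le (hcont.comp (f := fun px => ((x, y, t, px, 0) : Xi n)) (by fun_prop))
      continuous_const
  filter_upwards [aux_nest ht] with px hpx
  have hll : LocallyLipschitz (fun q => G x y t px q) :=
    (hL x px).comp (f := fun q : ℝ × ℝ × ℝ => G x q.1 q.2.1 px q.2.2)
      (g := fun q : ℝ => (y, t, q))
      ((LipschitzWith.prodMk_left y).comp (LipschitzWith.prodMk_left t)).locallyLipschitz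
  refine aux_mvt hll ?_
  filter_upwards [hpx] with r hr _ using hr

lemma G_lip_y (h1 : HypH1 G) (h3 : HypH3 G l C₃ C₄ C₅) (x : Euc n) (y y' t : ℝ) (px : Euc n)
    (q : ℝ) : |G x y t px q - G x y' t px q| ≤ C₃ * |q + l| * |y - y'| := by
  obtain ⟨_, _, _, hL, hae⟩ := h3
  have hG := h1.1
  have hae' : ∀ᵐ ξ ∂(volume : Measure (Xi n)),
      |deriv (fun y => G ξ.1 y ξ.2.2.1 ξ.2.2.2.1 ξ.2.2.2.2) ξ.2.1| ≤ C₃ * |ξ.2.2.2.2 + l| := by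
    filter_upwards [hae] with ξ h using h.1
  have hcont : Continuous (fun ξ : Xi n => |G ξ.1 y ξ.2.2.1 ξ.2.2.2.1 ξ.2.2.2.2 -
      G ξ.1 y' ξ.2.2.1 ξ.2.2.2.1 ξ.2.2.2.2|) := by
    refine Continuous.abs (Continuous.sub ?_ ?_)
    · exact hG.comp (f := fun ξ : Xi n => ((ξ.1, y, ξ.2.2.1, ξ.2.2.2.1, ξ.2.2.2.2) : Xi n))
        (by fun_prop)
    · exact hG.comp (f := fun ξ : Xi n => ((ξ.1, y', ξ.2.2.1, ξ.2.2.2.1, ξ.2.2.2.2) : Xi n))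
        (by fun_prop)
  have A1 := aux_nest hae'
  refine aux_closed (p := fun x => |G x y t px q - G x y' t px q| ≤ C₃ * |q + l| * |y - y'|)
    (μ := volume) ?_ ?_ x
  swap
  · exact isClosed_le (hcont.comp (f := fun x => ((x, 0, t, px, q) : Xi n)) (by fun_prop))
      continuous_const
  filter_upwards [A1] with x hx
  refine aux_closed (p := fun r : ℝ × Euc n × ℝ =>
    |G x y r.1 r.2.1 r.2.2 - G x y' r.1 r.2.1 r.2.2| ≤ C₃ * |r.2.2 + l| * |y - y'|)
    (μ := volume) ?_ ?_ (t, px, q)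
  swap
  · exact isClosed_le (hcont.comp (f := fun r : ℝ × Euc n × ℝ => ((x, 0, r) : Xi n))
      (by fun_prop)) (by fun_prop)
  filter_upwards [aux_swap hx] with r hr
  have hll : LocallyLipschitz (fun y => G x y r.1 r.2.1 r.2.2) :=
    (hL x r.2.1).comp (f := fun q : ℝ × ℝ × ℝ => G x q.1 q.2.1 r.2.1 q.2.2)
      (g := fun y : ℝ => (y, r.1, r.2.2))
      ((LipschitzWith.prodMk_right (r.1, r.2.2))).locallyLipschitz
  refine aux_mvt hll ?_
  filter_upwards [hr] with y hy _ using hy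

lemma G_lip_t (h1 : HypH1 G) (h3 : HypH3 G l C₃ C₄ C₅) (x : Euc n) (y t t' : ℝ) (px : Euc n)
    (q : ℝ) (htt : C₄ * |t' - t| ≤ 1 / 2) :
    |G x y t' px q - G x y t px q| ≤ 2 * C₄ * |t' - t| * (1 + |q| + |G x y t px q|) := by
  obtain ⟨_, hC4, _, hL, hae⟩ := h3
  have hG := h1.1
  have hae' : ∀ᵐ ξ ∂(volume : Measure (Xi n)),
      |deriv (fun t => G ξ.1 ξ.2.1 t ξ.2.2.2.1 ξ.2.2.2.2) ξ.2.2.1| ≤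
      C₄ * (1 + |ξ.2.2.2.2| + |G ξ.1 ξ.2.1 ξ.2.2.1 ξ.2.2.2.1 ξ.2.2.2.2|) := by
    filter_upwards [hae] with ξ h using h.2.1
  have hc0 : ∀ s : ℝ, Continuous (fun ξ : Xi n => G ξ.1 ξ.2.1 s ξ.2.2.2.1 ξ.2.2.2.2) := fun s =>
    hG.comp (f := fun ξ : Xi n => ((ξ.1, ξ.2.1, s, ξ.2.2.2.1, ξ.2.2.2.2) : Xi n)) (by fun_prop)
  have hcl : IsClosed {ξ : Xi n |
      |G ξ.1 ξ.2.1 t' ξ.2.2.2.1 ξ.2.2.2.2 - G ξ.1 ξ.2.1 t ξ.2.2.2.1 ξ.2.2.2.2| ≤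
      2 * C₄ * |t' - t| * (1 + |ξ.2.2.2.2| + |G ξ.1 ξ.2.1 t ξ.2.2.2.1 ξ.2.2.2.2|)} := by
    have ha := hc0 t
    have hb := hc0 t'
    exact isClosed_le (by fun_prop) (by fun_prop)
  refine aux_closed (p := fun x => |G x y t' px q - G x y t px q| ≤
    2 * C₄ * |t' - t| * (1 + |q| + |G x y t px q|)) (μ := volume) ?_ ?_ x
  swap
  · exact hcl.preimage (f := fun x => ((x, y, 0, px, q) : Xi n)) (by fun_prop)
  filter_upwards [aux_nest hae'] with x hx
  refine aux_closed (p := fun y => |G x y t' px q - G x y t px q| ≤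
    2 * C₄ * |t' - t| * (1 + |q| + |G x y t px q|)) (μ := volume) ?_ ?_ y
  swap
  · exact hcl.preimage (f := fun y => ((x, y, 0, px, q) : Xi n)) (by fun_prop)
  filter_upwards [aux_nest hx] with y hy
  refine aux_closed (p := fun r : Euc n × ℝ => |G x y t' r.1 r.2 - G x y t r.1 r.2| ≤
    2 * C₄ * |t' - t| * (1 + |r.2| + |G x y t r.1 r.2|)) (μ := volume) ?_ ?_ (px, q)
  swap
  · exact hcl.preimage (f := fun r => ((x, y, 0, r) : Xi n)) (by fun_prop)
  filter_upwards [aux_swap hy] with r hr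
  have hll : LocallyLipschitz (fun t => G x y t r.1 r.2) :=
    (hL x r.1).comp (f := fun q : ℝ × ℝ × ℝ => G x q.1 q.2.1 r.1 q.2.2)
      (g := fun t : ℝ => (y, t, r.2))
      ((LipschitzWith.prodMk_left y).comp (LipschitzWith.prodMk_right r.2)).locallyLipschitz
  exact aux_gron hll hC4 hr htt

/-- Uniform continuity of G on bounded sets of momenta. -/
lemma G_unif (h1 : HypH1 G) (R ε : ℝ) (hε : 0 < ε) :
    ∃ ρ : ℝ, 0 < ρ ∧ ∀ (x x' : Euc n) (y t : ℝ) (px px' : Euc n) (q q' : ℝ),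
      ‖px‖ ≤ R → |q| ≤ R → ‖x - x'‖ < ρ → ‖px - px'‖ < ρ → |q - q'| < ρ →
      |G x y t px q - G x' y t px' q'| ≤ ε := by
  obtain ⟨hG, hx, hy, ht⟩ := h1
  let S : Set (Xi n) := Metric.closedBall 0 ((n : ℝ) + 1 + (|R| + 1))
  have hS : IsCompact S := isCompact_closedBall _ _
  have huc := hS.uniformContinuousOn_of_continuous hG.continuousOn
  obtain ⟨ρ, hρ, hρ2⟩ := Metric.uniformContinuousOn_iff.mp huc ε hε
  refine ⟨min ρ 1, by positivity, ?_⟩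
  intro x x' y t px px' q q' hpx hq hxx hpp hqq
  have hy' : ∀ (k : ℤ) x y t px py, G x (y + k) t px py = G x y t px py := by
    intro k x y t px py
    have : Function.Periodic (fun y => G x y t px py) 1 := fun y => hy x y t px py
    simpa using (this.int_mul k) y
  have ht' : ∀ (k : ℤ) x y t px py, G x y (t + k) px py = G x y t px py := by
    intro k x y t px py
    have : Function.Periodic (fun t => G x y t px py) 1 := fun t => ht x y t px py
    simpa using (this.int_mul k) t
  set k : Fin n → ℤ := fun i => -⌊x i⌋ with hk
  have e1 : G x y t px q = G (x + intVec k) (Int.fract y) (Int.fract t) px q := by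
    rw [hx, ← hy' ⌊y⌋ x (Int.fract y), ← ht' ⌊t⌋ x _ (Int.fract t), Int.fract_add_floor,
      Int.fract_add_floor]
  have e2 : G x' y t px' q' = G (x' + intVec k) (Int.fract y) (Int.fract t) px' q' := by
    rw [hx, ← hy' ⌊y⌋ x' (Int.fract y), ← ht' ⌊t⌋ x' _ (Int.fract t), Int.fract_add_floor,
      Int.fract_add_floor]
  have hR : R ≤ |R| := le_abs_self R
  have hn0 : (0 : ℝ) ≤ n := Nat.cast_nonneg n
  have hR0 : 0 ≤ |R| := abs_nonneg R
  have hxn : ‖x + intVec k‖ ≤ n := by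
    have hle : ‖x + intVec k‖ ≤ ∑ i : Fin n, ‖(x + intVec k) i‖ := by
      rw [EuclideanSpace.norm_eq]
      apply Real.sqrt_le_iff.mpr
      refine ⟨Finset.sum_nonneg fun i _ => norm_nonneg _, ?_⟩
      exact Finset.sum_sq_le_sq_sum_of_nonneg fun i _ => norm_nonneg _
    refine hle.trans ?_
    have : ∀ i ∈ Finset.univ, ‖(x + intVec k) i‖ ≤ (1 : ℝ) := by
      intro i _
      have : (x + intVec k) i = Int.fract (x i) := by
        simp [intVec, hk, Int.fract, sub_eq_add_neg]
      rw [this, Real.norm_eq_abs, abs_of_nonneg (Int.fract_nonneg _)]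
      exact (Int.fract_lt_one _).le
    simpa using Finset.sum_le_sum this
  have hxx1 : ‖x - x'‖ < 1 := hxx.trans_le (min_le_right _ _)
  have hpp1 : ‖px - px'‖ < 1 := hpp.trans_le (min_le_right _ _)
  have hqq1 : |q - q'| < 1 := hqq.trans_le (min_le_right _ _)
  have hxn' : ‖x' + intVec k‖ ≤ n + 1 := by
    have : x' + intVec k = (x + intVec k) - (x - x') := by abel
    rw [this]
    exact (norm_sub_le _ _).trans (by linarith)
  have hpx' : ‖px'‖ ≤ R + 1 := by
    have : px' = px - (px - px') := by abel
    rw [this]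
    exact (norm_sub_le _ _).trans (by linarith)
  have hq' : |q'| ≤ R + 1 := by
    have : q' = q - (q - q') := by ring
    rw [this]
    exact (abs_sub _ _).trans (by linarith)
  have hfy : |Int.fract y| ≤ 1 := by
    rw [abs_of_nonneg (Int.fract_nonneg _)]; exact (Int.fract_lt_one _).le
  have hft : |Int.fract t| ≤ 1 := by
    rw [abs_of_nonneg (Int.fract_nonneg _)]; exact (Int.fract_lt_one _).le
  rw [e1, e2]
  refine le_of_lt (hρ2 (x + intVec k, Int.fract y, Int.fract t, px, q) ?_
    (x' + intVec k, Int.fract y, Int.fract t, px', q') ?_ ?_)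
  · simp only [S, mem_closedBall_zero_iff, Prod.norm_def, Real.norm_eq_abs, sup_le_iff]
    refine ⟨?_, ?_, ?_, ?_, ?_⟩ <;> linarith
  · simp only [S, mem_closedBall_zero_iff, Prod.norm_def, Real.norm_eq_abs, sup_le_iff]
    refine ⟨?_, ?_, ?_, ?_, ?_⟩ <;> linarith
  · have hm := min_le_left ρ 1
    simp only [Prod.dist_eq, dist_add_right, dist_self, sup_lt_iff]
    rw [dist_eq_norm, dist_eq_norm, Real.dist_eq]
    refine ⟨?_, ?_, ?_, ?_, ?_⟩ <;> linarith

end HamEst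

section Compare
variable {n : ℕ}

lemma periodic_bdd {u : Dom n → ℝ} (hp : STPeriodic u) (hc : Continuous u) : Bdd u := by
  obtain ⟨hx, hy, ht⟩ := hp
  have hS : IsCompact (Metric.closedBall (0 : Dom n) ((n : ℝ) + 1)) := isCompact_closedBall _ _
  obtain ⟨M, hM⟩ := hS.exists_bound_of_continuousOn hc.continuousOn
  refine ⟨M, ?_⟩
  rintro ⟨x, y, t⟩
  have hy' : ∀ (k : ℤ) x y t, u (x, y + k, t) = u (x, y, t) := by
    intro k x y t
    have : Function.Periodic (fun y => u (x, y, t)) 1 := fun y => hy x y t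
    simpa using (this.int_mul k) y
  have ht' : ∀ (k : ℤ) x y t, u (x, y, t + k) = u (x, y, t) := by
    intro k x y t
    have : Function.Periodic (fun t => u (x, y, t)) 1 := fun t => ht x y t
    simpa using (this.int_mul k) t
  set k : Fin n → ℤ := fun i => -⌊x i⌋ with hk
  have e1 : u (x, y, t) = u (x + intVec k, Int.fract y, Int.fract t) := by
    rw [hx, ← hy' ⌊y⌋ x (Int.fract y), ← ht' ⌊t⌋ x _ (Int.fract t), Int.fract_add_floor,
      Int.fract_add_floor]
  have hn0 : (0 : ℝ) ≤ n := Nat.cast_nonneg n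
  have hxn : ‖x + intVec k‖ ≤ n := by
    have hle : ‖x + intVec k‖ ≤ ∑ i : Fin n, ‖(x + intVec k) i‖ := by
      rw [EuclideanSpace.norm_eq]
      apply Real.sqrt_le_iff.mpr
      refine ⟨Finset.sum_nonneg fun i _ => norm_nonneg _, ?_⟩
      exact Finset.sum_sq_le_sq_sum_of_nonneg fun i _ => norm_nonneg _
    refine hle.trans ?_
    have : ∀ i ∈ Finset.univ, ‖(x + intVec k) i‖ ≤ (1 : ℝ) := by
      intro i _
      have : (x + intVec k) i = Int.fract (x i) := by
        simp [intVec, hk, Int.fract, sub_eq_add_neg]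
      rw [this, Real.norm_eq_abs, abs_of_nonneg (Int.fract_nonneg _)]
      exact (Int.fract_lt_one _).le
    simpa using Finset.sum_le_sum this
  have hfy : |Int.fract y| ≤ 1 := by
    rw [abs_of_nonneg (Int.fract_nonneg _)]; exact (Int.fract_lt_one _).le
  have hft : |Int.fract t| ≤ 1 := by
    rw [abs_of_nonneg (Int.fract_nonneg _)]; exact (Int.fract_lt_one _).le
  rw [e1]
  apply hM
  simp only [mem_closedBall_zero_iff, Prod.norm_def, Real.norm_eq_abs, sup_le_iff]
  refine ⟨?_, ?_, ?_⟩ <;> linarith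

/-- The quadratic penalty centered at `p`. -/
def Qd (a b : ℝ) (p w : Dom n) : ℝ :=
  a * ‖w.1 - p.1‖ ^ 2 + b * ((w.2.1 - p.2.1) ^ 2 + (w.2.2 - p.2.2) ^ 2)

lemma Qd_contDiff (a b : ℝ) (p : Dom n) : ContDiff ℝ 1 (Qd a b p) := by
  unfold Qd
  have : ContDiff ℝ 1 (fun w : Dom n => ‖w.1 - p.1‖ ^ 2) :=
    (contDiff_fst.sub contDiff_const).norm_sq ℝ
  fun_prop

lemma Qd_cont (a b : ℝ) : Continuous (fun z : Dom n × Dom n => Qd a b z.1 z.2) := by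
  unfold Qd
  fun_prop

lemma Qd_fderiv (a b : ℝ) (p w v : Dom n) : fderiv ℝ (Qd a b p) w v =
    2 * a * inner ℝ (w.1 - p.1) v.1 + 2 * b * ((w.2.1 - p.2.1) * v.2.1 +
      (w.2.2 - p.2.2) * v.2.2) := by
  have h1 : HasFDerivAt (fun w : Dom n => w.1 - p.1) (ContinuousLinearMap.fst ℝ (Euc n) (ℝ × ℝ)) w :=
    hasFDerivAt_fst.sub_const _
  have h2 : HasFDerivAt (fun w : Dom n => w.2.1 - p.2.1)
      ((ContinuousLinearMap.fst ℝ ℝ ℝ).comp (ContinuousLinearMap.snd ℝ (Euc n) (ℝ × ℝ))) w :=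
    ((ContinuousLinearMap.fst ℝ ℝ ℝ).comp
      (ContinuousLinearMap.snd ℝ (Euc n) (ℝ × ℝ))).hasFDerivAt.sub_const _
  have h3 : HasFDerivAt (fun w : Dom n => w.2.2 - p.2.2)
      ((ContinuousLinearMap.snd ℝ ℝ ℝ).comp (ContinuousLinearMap.snd ℝ (Euc n) (ℝ × ℝ))) w :=
    ((ContinuousLinearMap.snd ℝ ℝ ℝ).comp
      (ContinuousLinearMap.snd ℝ (Euc n) (ℝ × ℝ))).hasFDerivAt.sub_const _
  have h := (h1.norm_sq.const_mul a).add (((h2.pow 2).add (h3.pow 2)).const_mul b)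
  have h' : HasFDerivAt (Qd a b p) _ w := h
  rw [h'.fderiv]
  rw [inner_sub_left]
  simp
  ring

/-- The test function. -/
def Tst (a b g : ℝ) (p c w : Dom n) : ℝ := Qd a b p w + Qd g g c w

lemma Tst_contDiff (a b g : ℝ) (p c : Dom n) : ContDiff ℝ 1 (Tst a b g p c) :=
  (Qd_contDiff a b p).add (Qd_contDiff g g c)

lemma Tst_fderiv (a b g : ℝ) (p c w v : Dom n) : fderiv ℝ (Tst a b g p c) w v =
    fderiv ℝ (Qd a b p) w v + fderiv ℝ (Qd g g c) w v := by
  have h := ((Qd_contDiff a b p).differentiable one_ne_zero w).hasFDerivAt.add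
    ((Qd_contDiff g g c).differentiable one_ne_zero w).hasFDerivAt
  have h' : HasFDerivAt (Tst a b g p c) _ w := h
  rw [h'.fderiv]
  simp

lemma Tst_pdT (a b g : ℝ) (p c w : Dom n) : pdT (Tst a b g p c) w =
    2 * b * (w.2.2 - p.2.2) + 2 * g * (w.2.2 - c.2.2) := by
  simp [pdT, Tst_fderiv, Qd_fderiv]

lemma Tst_pdY (a b g : ℝ) (p c w : Dom n) : pdY (Tst a b g p c) w =
    2 * b * (w.2.1 - p.2.1) + 2 * g * (w.2.1 - c.2.1) := by
  simp [pdY, Tst_fderiv, Qd_fderiv]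

lemma Tst_pdX (a b g : ℝ) (p c w : Dom n) : pdX (Tst a b g p c) w =
    (2 * a) • (w.1 - p.1) + (2 * g) • (w.1 - c.1) := by
  ext i
  simp [pdX, Tst_fderiv, Qd_fderiv, EuclideanSpace.inner_single_right]

/-- Approximate maximum with a small quadratic perturbation. -/
lemma approx_max {f : Dom n × Dom n → ℝ} (hf : UpperSemicontinuous f) {M : ℝ}
    (hM : ∀ z, f z ≤ M) {g : ℝ} (hg : 0 < g) :
    ∃ c z : Dom n × Dom n,
      (∀ w, f w - (Qd g g c.1 w.1 + Qd g g c.2 w.2) ≤ f z - (Qd g g c.1 z.1 + Qd g g c.2 z.2)) ∧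
      (∀ w, f w ≤ f z + g) ∧ Qd 1 1 c.1 z.1 + Qd 1 1 c.2 z.2 ≤ 1 := by
  have hbdd : BddAbove (Set.range f) := ⟨M, by rintro _ ⟨z, rfl⟩; exact hM z⟩
  obtain ⟨c, hc⟩ := exists_lt_of_lt_ciSup (show (⨆ z, f z) - g < ⨆ z, f z by linarith)
  have hle : ∀ z, f z ≤ ⨆ z, f z := fun z => le_ciSup hbdd z
  have hQg : ∀ p w : Dom n, Qd g g p w = g * Qd 1 1 p w := by intro p w; simp [Qd]; ring
  have hQ0 : ∀ p w : Dom n, 0 ≤ Qd 1 1 p w := by intro p w; simp only [Qd]; positivity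
  have hQc : ∀ p : Dom n, Qd 1 1 p p = 0 := by intro p; simp [Qd]
  have hQcont : Continuous (fun w : Dom n × Dom n => Qd 1 1 c.1 w.1 + Qd 1 1 c.2 w.2) :=
    ((Qd_contDiff 1 1 c.1).continuous.comp continuous_fst).add
      ((Qd_contDiff 1 1 c.2).continuous.comp continuous_snd)
  let S : Set (Dom n × Dom n) := {w | Qd 1 1 c.1 w.1 + Qd 1 1 c.2 w.2 ≤ 1}
  have hScl : IsClosed S := isClosed_le hQcont continuous_const
  have hSsub : S ⊆ Metric.closedBall c 1 := by
    intro w hw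
    have h0 : ∀ p w : Dom n, Qd 1 1 p w ≤ 1 → dist w p ≤ 1 := by
      intro p w h
      simp only [Qd, one_mul] at h
      have e1 := sq_nonneg ‖w.1 - p.1‖
      have e2 := sq_nonneg (w.2.1 - p.2.1)
      have e3 := sq_nonneg (w.2.2 - p.2.2)
      simp only [Prod.dist_eq, sup_le_iff]
      rw [dist_eq_norm, Real.dist_eq, Real.dist_eq]
      refine ⟨?_, ?_, ?_⟩
      · exact (le_abs_self _).trans
          (abs_le_of_sq_le_sq (by linarith : ‖w.1 - p.1‖ ^ 2 ≤ 1 ^ 2) zero_le_one)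
      · exact sq_le_one_iff_abs_le_one _ |>.mp (by linarith)
      · exact sq_le_one_iff_abs_le_one _ |>.mp (by linarith)
    have hw' : Qd 1 1 c.1 w.1 + Qd 1 1 c.2 w.2 ≤ 1 := hw
    rw [Metric.mem_closedBall, Prod.dist_eq, sup_le_iff]
    exact ⟨h0 _ _ (by linarith [hQ0 c.2 w.2]), h0 _ _ (by linarith [hQ0 c.1 w.1])⟩
  have hSc : IsCompact S := (isCompact_closedBall c 1).of_isClosed_subset hScl hSsub
  have hcS : c ∈ S := by simp [S, hQc]
  have hgusc : UpperSemicontinuous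
      (fun w => f w + -(g * (Qd 1 1 c.1 w.1 + Qd 1 1 c.2 w.2))) :=
    hf.add ((continuous_const.mul hQcont).neg.upperSemicontinuous)
  obtain ⟨z, hzS, hz⟩ := (hgusc.upperSemicontinuousOn S).exists_isMaxOn ⟨c, hcS⟩ hSc
  have hz' : ∀ w ∈ S, f w - g * (Qd 1 1 c.1 w.1 + Qd 1 1 c.2 w.2) ≤
      f z - g * (Qd 1 1 c.1 z.1 + Qd 1 1 c.2 z.2) := fun w hw => by
    have := hz hw
    simp only [Set.mem_ofPred_eq] at this
    linarith
  have hcz := hz' c hcS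
  simp only [hQc, add_zero, mul_zero, sub_zero] at hcz
  have hzpos : 0 ≤ g * (Qd 1 1 c.1 z.1 + Qd 1 1 c.2 z.2) :=
    mul_nonneg hg.le (add_nonneg (hQ0 _ _) (hQ0 _ _))
  refine ⟨c, z, ?_, ?_, hzS⟩
  · intro w
    simp only [hQg, ← mul_add]
    by_cases hw : w ∈ S
    · exact hz' w hw
    · have hw' : 1 < Qd 1 1 c.1 w.1 + Qd 1 1 c.2 w.2 := not_le.mp hw
      have := hle w
      nlinarith
  · intro w
    have := hle w
    linarith

/-- Selection of penalty parameters. -/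
lemma select_param (M : ℕ → ℕ → ℝ) (m0 m1 : ℝ) (hlo : ∀ k j, m0 ≤ M k j)
    (hhi : ∀ k j, M k j ≤ m1) (hanti : ∀ j, Antitone (fun k => M k j)) {s : ℝ} (hs : 0 < s) :
    ∃ j k0, ∀ k ≥ k0, M k j - M k (j + 1) ≤ s := by
  have hb : ∀ j, BddBelow (Set.range fun k => M k j) := fun j => ⟨m0, by
    rintro _ ⟨k, rfl⟩; exact hlo k j⟩
  set m : ℕ → ℝ := fun j => ⨅ k, M k j with hm
  have hm0 : ∀ j, m0 ≤ m j := fun j => le_ciInf fun k => hlo k j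
  have hm1 : ∀ j, m j ≤ m1 := fun j => (ciInf_le (hb j) 0).trans (hhi 0 j)
  obtain ⟨j, hj⟩ : ∃ j, m j - m (j + 1) < s / 2 := by
    by_contra hcon
    push Not at hcon
    have : ∀ j : ℕ, (j : ℝ) * (s / 2) ≤ m 0 - m j := by
      intro j
      induction j with
      | zero => simp
      | succ j ih =>
        have := hcon j
        push_cast
        linarith
    obtain ⟨N, hN⟩ := exists_nat_gt ((m1 - m0) / (s / 2))
    rw [div_lt_iff₀ (by positivity)] at hN
    have h1 := this N
    have h2 := hm0 N
    have h3 := hm1 0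
    linarith
  obtain ⟨k0, hk0⟩ := exists_lt_of_ciInf_lt (show (⨅ k, M k j) < m j + s / 2 by
    simp only [hm]; linarith)
  refine ⟨j, k0, fun k hk => ?_⟩
  have h1 : M k j ≤ M k0 j := hanti j hk
  have h2 : m (j + 1) ≤ M k (j + 1) := ciInf_le (hb (j + 1)) k
  linarith

end Compare

section Main
variable {n : ℕ}

lemma Qd_symm (a b : ℝ) (p w : Dom n) : Qd a b p w = Qd a b w p := by
  simp only [Qd]
  rw [norm_sub_rev]
  ring

lemma Qd_neg (a b : ℝ) (p w : Dom n) : Qd (-a) (-b) p w = - Qd a b p w := by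
  simp only [Qd]
  ring

lemma Qd_le_one {p w : Dom n} (h : Qd 1 1 p w ≤ 1) :
    ‖w.1 - p.1‖ ≤ 1 ∧ |w.2.1 - p.2.1| ≤ 1 ∧ |w.2.2 - p.2.2| ≤ 1 := by
  simp only [Qd, one_mul] at h
  have e1 := sq_nonneg ‖w.1 - p.1‖
  have e2 := sq_nonneg (w.2.1 - p.2.1)
  have e3 := sq_nonneg (w.2.2 - p.2.2)
  refine ⟨?_, ?_, ?_⟩
  · exact (le_abs_self _).trans
      (abs_le_of_sq_le_sq (by linarith : ‖w.1 - p.1‖ ^ 2 ≤ 1 ^ 2) zero_le_one)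
  · exact sq_le_one_iff_abs_le_one _ |>.mp (by linarith)
  · exact sq_le_one_iff_abs_le_one _ |>.mp (by linarith)

/-- Existence of doubled points with good penalty bounds. -/
lemma doubling {u v : Dom n → ℝ} (hu : UpperSemicontinuous u) (hv : LowerSemicontinuous v)
    {Mu Mv : ℝ} (hMu : ∀ z, |u z| ≤ Mu) (hMv : ∀ z, |v z| ≤ Mv) {τ : ℝ} (hτ : 0 < τ) :
    ∃ b : ℝ, 1 ≤ b ∧ ∃ k0 : ℕ, ∀ k : ℕ, k0 ≤ k → ∀ g : ℝ, 0 < g → g ≤ τ ^ 2 / 4 →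
      ∃ c c' z z' : Dom n,
        Qd 1 1 c z ≤ 1 ∧ Qd 1 1 c' z' ≤ 1 ∧
        IsLocalMax (fun w => u w - Tst k b g z' c w) z ∧
        IsLocalMin (fun w => v w - Tst (-k) (-b) (-g) z c' w) z' ∧
        (∀ z0, u z0 - v z0 ≤ u z - v z' + g) ∧
        b * ((z.2.1 - z'.2.1) ^ 2 + (z.2.2 - z'.2.2) ^ 2) ≤ τ ^ 2 := by
  let F : ℝ → ℝ → Dom n × Dom n → ℝ := fun a b z => u z.1 - v z.2 - Qd a b z.2 z.1
  have hF1 : ∀ a b : ℝ, 0 ≤ a → 0 ≤ b → ∀ z, F a b z ≤ Mu + Mv := by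
    intro a b ha hb z
    have h1 := (abs_le.mp (hMu z.1)).2
    have h2 := (abs_le.mp (hMv z.2)).1
    have h3 : 0 ≤ Qd a b z.2 z.1 := by simp only [Qd]; positivity
    simp only [F]
    linarith
  have hFb : ∀ a b : ℝ, 0 ≤ a → 0 ≤ b → BddAbove (Set.range (F a b)) := fun a b ha hb =>
    ⟨Mu + Mv, by rintro _ ⟨z, rfl⟩; exact hF1 a b ha hb z⟩
  let M : ℕ → ℕ → ℝ := fun k j => ⨆ z, F k (2 ^ j) z
  have hp : ∀ j : ℕ, (0 : ℝ) ≤ 2 ^ j := fun j => by positivity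
  obtain ⟨j, k0, hjk⟩ := select_param M (-(Mu + Mv)) (Mu + Mv)
    (by
      intro k j
      refine le_trans ?_ (le_ciSup (hFb k (2 ^ j) k.cast_nonneg (hp j)) (0, 0))
      have h1 := (abs_le.mp (hMu 0)).1
      have h2 := (abs_le.mp (hMv 0)).2
      simp only [F, Qd, sub_self, norm_zero]
      simp
      linarith)
    (fun k j => ciSup_le fun z => hF1 k (2 ^ j) k.cast_nonneg (hp j) z)
    (by
      intro j k k' hkk
      refine ciSup_mono (hFb k (2 ^ j) k.cast_nonneg (hp j)) fun z => ?_
      have : (k : ℝ) ≤ k' := by exact_mod_cast hkk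
      simp only [F, Qd]
      gcongr) (s := τ ^ 2 / 4) (by positivity)
  refine ⟨2 ^ (j + 1), one_le_pow₀ (by norm_num), k0, ?_⟩
  intro k hk g hg hgτ
  have husc : UpperSemicontinuous (F k (2 ^ (j + 1))) := by
    have h1 : UpperSemicontinuous (fun z : Dom n × Dom n => u z.1) := hu.comp continuous_fst
    have h2 : UpperSemicontinuous (fun z : Dom n × Dom n => - v z.2) :=
      continuous_neg.comp_lowerSemicontinuous_antitone (hv.comp continuous_snd)
        (fun _ _ h => neg_le_neg h)
    have h3 : UpperSemicontinuous (fun z : Dom n × Dom n => - Qd k (2 ^ (j + 1)) z.2 z.1) :=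
      ((Qd_cont k (2 ^ (j + 1))).comp continuous_swap).neg.upperSemicontinuous
    have h4 := (h1.add h2).add h3
    have e : F k (2 ^ (j + 1)) =
        fun z => u z.1 + - v z.2 + - Qd k (2 ^ (j + 1)) z.2 z.1 := by
      funext z; simp only [F]; ring
    rw [e]; exact h4
  obtain ⟨c, z, hmax, happ, hcz⟩ := approx_max husc
    (hF1 k (2 ^ (j + 1)) k.cast_nonneg (hp _)) hg
  have hQ0 : ∀ p w : Dom n, 0 ≤ Qd 1 1 p w := by intro p w; simp only [Qd]; positivity
  refine ⟨c.1, c.2, z.1, z.2, ?_, ?_, ?_, ?_, ?_, ?_⟩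
  · linarith [hQ0 c.2 z.2]
  · linarith [hQ0 c.1 z.1]
  · refine Filter.Eventually.of_forall fun w => ?_
    have := hmax (w, z.2)
    simp only [F] at this
    simp only [Tst]
    linarith
  · refine Filter.Eventually.of_forall fun w => ?_
    have := hmax (z.1, w)
    simp only [F] at this
    simp only [Tst, Qd_neg]
    rw [Qd_symm _ _ z.1 w, Qd_symm _ _ z.1 z.2]
    linarith
  · intro z0
    have := happ (z0, z0)
    have h3 : 0 ≤ Qd k (2 ^ (j + 1)) z.2 z.1 := by simp only [Qd]; positivity
    have h4 : Qd k (2 ^ (j + 1)) z0 z0 = 0 := by simp [Qd]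
    simp only [F] at this
    linarith
  · have h1 := hjk k hk
    have h2 : F k (2 ^ j) z ≤ M k j := le_ciSup (hFb k (2 ^ j) k.cast_nonneg (hp j)) z
    have h3 : M k (j + 1) ≤ F k (2 ^ (j + 1)) z + g := ciSup_le happ
    have h4 : F k (2 ^ j) z = F k (2 ^ (j + 1)) z +
        (2 ^ j) * ((z.1.2.1 - z.2.2.1) ^ 2 + (z.1.2.2 - z.2.2.2) ^ 2) := by
      simp only [F, Qd]; ring
    rw [pow_succ]
    linarith

lemma arith_pen {b s r τ : ℝ} (hb : 1 ≤ b) (hτ : 0 < τ)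
    (hτ1 : τ ≤ 1) (hpen : b * (s ^ 2 + r ^ 2) ≤ τ ^ 2) :
    s ≤ τ ∧ r ≤ τ ∧ b * s ^ 2 ≤ τ ∧ b * r ^ 2 ≤ τ ∧ b * (r * s) ≤ τ := by
  have hb0 : 0 < b := by linarith
  have hττ : τ ^ 2 ≤ τ := by nlinarith
  have h1 : s ^ 2 ≤ b * s ^ 2 := le_mul_of_one_le_left (sq_nonneg s) hb
  have h2 : r ^ 2 ≤ b * r ^ 2 := le_mul_of_one_le_left (sq_nonneg r) hb
  have h3 := sq_nonneg s
  have h4 := sq_nonneg r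
  have h5 : b * (r * s) ≤ b * (s ^ 2 + r ^ 2) := by
    apply mul_le_mul_of_nonneg_left _ hb0.le
    nlinarith [sq_nonneg (r - s)]
  rw [mul_add] at hpen h5
  refine ⟨(abs_le_of_sq_le_sq' (by linarith) hτ.le).2, (abs_le_of_sq_le_sq' (by linarith) hτ.le).2,
    by linarith, by linarith, by linarith⟩

lemma G_low {G : Ham n} {C₁ C₂ l C₃ C₄ C₅ : ℝ}
    (h1 : HypH1 G) (h2 : HypH2 G C₁ C₂) (h3 : HypH3 G l C₃ C₄ C₅)
    (x : Euc n) (y t : ℝ) (Px : Euc n) (Py : ℝ) :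
    C₁ * ‖Px‖ - C₂ - C₅ * |Py| ≤ G x y t Px Py := by
  have e1 := h2.2.2 x y t Px
  have e2 := (abs_le.mp (G_lip_py h1 h3 x y t Px Py 0)).1
  rw [sub_zero] at e2
  linarith

lemma Px_bound {G : Ham n} {C₁ C₂ l C₃ C₄ C₅ : ℝ}
    (h1 : HypH1 G) (h2 : HypH2 G C₁ C₂) (h3 : HypH3 G l C₃ C₄ C₅)
    (x : Euc n) (y t : ℝ) (Px : Euc n) (Py : ℝ) {K0 b s r : ℝ} (hb : 1 ≤ b)
    (hs1 : s ≤ 1) (hr1 : r ≤ 1) (hPyb : |Py| ≤ 2 * b * s + 1)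
    (hGup : G x y t Px Py ≤ K0 + 1 + 2 * b * r) :
    ‖Px‖ ≤ (C₂ + C₅ * (2 * b + 1) + K0 + 1 + 2 * b) / C₁ := by
  have hGlo := G_low h1 h2 h3 x y t Px Py
  have hC5 := h3.2.2.1
  have hbs : b * s ≤ b * 1 := mul_le_mul_of_nonneg_left hs1 (by linarith)
  have hbr : b * r ≤ b * 1 := mul_le_mul_of_nonneg_left hr1 (by linarith)
  rw [le_div_iff₀ h2.1]
  have e0 : C₅ * |Py| ≤ C₅ * (2 * b + 1) := mul_le_mul_of_nonneg_left (by linarith) hC5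
  linarith

lemma G_chain {G : Ham n} {C₁ C₂ l C₃ C₄ C₅ : ℝ}
    (h1 : HypH1 G) (h2 : HypH2 G C₁ C₂) (h3 : HypH3 G l C₃ C₄ C₅)
    (x : Euc n) (y y' t t' : ℝ) (Px : Euc n) (Py : ℝ) {K0 b s r τ : ℝ} (hb : 1 ≤ b)
    (hK0 : 0 ≤ K0) (hτ : 0 < τ) (hτ1 : τ ≤ 1) (hτC : C₄ * τ ≤ 1 / 2)
    (hs : s = |y - y'|) (hr : r = |t - t'|) (hpen : b * (s ^ 2 + r ^ 2) ≤ τ ^ 2)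
    (hPyb : |Py| ≤ 2 * b * s + 1)
    (hGup : G x y t Px Py ≤ K0 + 1 + 2 * b * r) :
    G x y' t' Px Py ≤ G x y t Px Py +
      (C₃ * (4 + |l|) + 2 * C₄ * (K0 + C₂ + 7 + 3 * C₅)) * τ := by
  have hC3 := h3.1
  have hC4 := h3.2.1
  have hC5 := h3.2.2.1
  have hC1 := h2.1
  have hC2 := h2.2.1
  have hs0 : 0 ≤ s := by rw [hs]; exact abs_nonneg _
  have hr0 : 0 ≤ r := by rw [hr]; exact abs_nonneg _
  have hb0 : 0 < b := by linarith
  obtain ⟨hsτ, hrτ, hbs, hbr, hbsr⟩ := arith_pen hb hτ hτ1 hpen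
  have hGlo := G_low h1 h2 h3 x y t Px Py
  have hPx0 : 0 ≤ C₁ * ‖Px‖ := by positivity
  have hGabs : |G x y t Px Py| ≤ K0 + 1 + 2 * b * r + C₂ + C₅ * |Py| := by
    have e0 : 0 ≤ C₅ * |Py| := by positivity
    have e1 : 0 ≤ 2 * b * r := by positivity
    rw [abs_le]
    constructor <;> linarith
  have c2 := (abs_le.mp (G_lip_y h1 h3 x y y' t' Px Py)).1
  have htt : |t' - t| = r := by rw [hr, abs_sub_comm]
  have hC4r : C₄ * r ≤ C₄ * τ := mul_le_mul_of_nonneg_left hrτ hC4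
  have c3 := (abs_le.mp (G_lip_t h1 h3 x y t t' Px Py (by rw [htt]; linarith))).2
  rw [htt] at c3
  rw [← hs] at c2
  have d2 : C₃ * |Py + l| * s ≤ C₃ * (4 + |l|) * τ := by
    have e1 : |Py + l| * s ≤ (4 + |l|) * τ := by
      have e2 : |Py + l| ≤ 2 * b * s + 1 + |l| := (abs_add_le _ _).trans (by linarith)
      have e3 : |Py + l| * s ≤ (2 * b * s + 1 + |l|) * s := by gcongr
      have e4 : |l| * s ≤ |l| * τ := by gcongr
      have e5 : (2 * b * s + 1 + |l|) * s = 2 * (b * s ^ 2) + s + |l| * s := by ring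
      linarith
    calc _ = C₃ * (|Py + l| * s) := by ring
      _ ≤ C₃ * ((4 + |l|) * τ) := by gcongr
      _ = _ := by ring
  have d3 : 2 * C₄ * r * (1 + |Py| + |G x y t Px Py|) ≤
      2 * C₄ * (K0 + C₂ + 7 + 3 * C₅) * τ := by
    have e1 : r * (1 + |Py| + |G x y t Px Py|) ≤ (K0 + C₂ + 7 + 3 * C₅) * τ := by
      have e2 : 1 + |Py| + |G x y t Px Py| ≤
          (K0 + 2 + C₂) + (1 + C₅) * (2 * b * s + 1) + 2 * b * r := by
        have : C₅ * |Py| ≤ C₅ * (2 * b * s + 1) := by gcongr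
        linarith
      have e3 : r * (1 + |Py| + |G x y t Px Py|) ≤
          r * ((K0 + 2 + C₂) + (1 + C₅) * (2 * b * s + 1) + 2 * b * r) := by gcongr
      have e4 : r * (K0 + 2 + C₂) ≤ τ * (K0 + 2 + C₂) := by gcongr
      have e5 : (1 + C₅) * (2 * (b * (r * s)) + r) ≤ (1 + C₅) * (2 * τ + τ) := by gcongr
      have e6 : r * ((K0 + 2 + C₂) + (1 + C₅) * (2 * b * s + 1) + 2 * b * r) =
        r * (K0 + 2 + C₂) + (1 + C₅) * (2 * (b * (r * s)) + r) + 2 * (b * r ^ 2) := by ring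
      linarith
    calc _ = 2 * C₄ * (r * (1 + |Py| + |G x y t Px Py|)) := by ring
      _ ≤ 2 * C₄ * ((K0 + C₂ + 7 + 3 * C₅) * τ) := by gcongr
      _ = _ := by ring
  linarith

set_option maxHeartbeats 1000000 in
lemma comparison {G : Ham n} {C₁ C₂ l C₃ C₄ C₅ : ℝ}
    (h1 : HypH1 G) (h2 : HypH2 G C₁ C₂) (h3 : HypH3 G l C₃ C₄ C₅)
    {α A B : ℝ} (hα : 0 ≤ α) {u v : Dom n → ℝ} (hub : Bdd u) (hvb : Bdd v)
    (hu : ViscSub G α A u) (hv : ViscSuper G α B v) (z0 : Dom n) :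
    α * (u z0 - v z0) ≤ A - B := by
  obtain ⟨Mu, hMu⟩ := hub
  obtain ⟨Mv, hMv⟩ := hvb
  obtain ⟨hC1, hC2, hco⟩ := h2
  have hC3 := h3.1
  have hC4 := h3.2.1
  have hC5 := h3.2.2.1
  have hMu0 : 0 ≤ Mu := (abs_nonneg _).trans (hMu 0)
  set K0 : ℝ := |A| + α * Mu with hK0
  have hK0n : 0 ≤ K0 := by positivity
  set K : ℝ := C₃ * (4 + |l|) + 2 * C₄ * (K0 + C₂ + 7 + 3 * C₅) with hK
  have hKn : 0 ≤ K := by positivity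
  refine le_of_forall_pos_le_add fun θ hθ => ?_
  obtain ⟨τ, hτ, hτ1, hτC, hτθ⟩ : ∃ τ : ℝ, 0 < τ ∧ τ ≤ 1 ∧ C₄ * τ ≤ 1 / 2 ∧
      (1 + K) * τ ≤ θ / 2 := by
    refine ⟨min 1 (min (1 / (2 * (C₄ + 1))) (θ / (2 * (1 + K)))), by positivity,
      min_le_left _ _, ?_, ?_⟩
    · have : min 1 (min (1 / (2 * (C₄ + 1))) (θ / (2 * (1 + K)))) ≤ 1 / (2 * (C₄ + 1)) :=
        (min_le_right _ _).trans (min_le_left _ _)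
      calc _ ≤ C₄ * (1 / (2 * (C₄ + 1))) := by gcongr
        _ ≤ 1 / 2 := by
          rw [mul_one_div, div_le_div_iff₀ (by positivity) (by norm_num)]; linarith
    · have : min 1 (min (1 / (2 * (C₄ + 1))) (θ / (2 * (1 + K)))) ≤ θ / (2 * (1 + K)) :=
        (min_le_right _ _).trans (min_le_right _ _)
      calc _ ≤ (1 + K) * (θ / (2 * (1 + K))) := by gcongr
        _ = θ / 2 := by field_simp
  obtain ⟨b, hb, k0, hdbl⟩ := doubling hu.1 hv.1 hMu hMv hτ
  set R : ℝ := (C₂ + C₅ * (2 * b + 1) + K0 + 1 + 2 * b) / C₁ with hR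
  have hRn : 0 ≤ R := by positivity
  obtain ⟨ρ, hρ, hunif⟩ := G_unif h1 (max R (2 * b + 1)) τ hτ
  obtain ⟨g, hg, hg1, hg2, hg3, hg4⟩ : ∃ g : ℝ, 0 < g ∧ g ≤ τ ^ 2 / 4 ∧ 2 * g ≤ 1 ∧
      4 * g < ρ ∧ (4 + α) * g ≤ θ / 2 := by
    refine ⟨min (τ ^ 2 / 4) (min (1 / 2) (min (ρ / 8) (θ / (2 * (4 + α))))), by positivity,
      min_le_left _ _, ?_, ?_, ?_⟩
    · have : min (τ ^ 2 / 4) (min (1 / 2) (min (ρ / 8) (θ / (2 * (4 + α))))) ≤ 1 / 2 :=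
        (min_le_right _ _).trans (min_le_left _ _)
      linarith
    · have : min (τ ^ 2 / 4) (min (1 / 2) (min (ρ / 8) (θ / (2 * (4 + α))))) ≤ ρ / 8 :=
        (min_le_right _ _).trans ((min_le_right _ _).trans (min_le_left _ _))
      linarith
    · have : min (τ ^ 2 / 4) (min (1 / 2) (min (ρ / 8) (θ / (2 * (4 + α))))) ≤
          θ / (2 * (4 + α)) :=
        (min_le_right _ _).trans ((min_le_right _ _).trans (min_le_right _ _))
      calc _ ≤ (4 + α) * (θ / (2 * (4 + α))) := by gcongr
        _ = θ / 2 := by field_simp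
  obtain ⟨k1, hk1⟩ := exists_nat_gt ((R + 1) / ρ)
  rw [div_lt_iff₀ hρ] at hk1
  set k : ℕ := max k0 k1 with hk
  have hkk1 : (k1 : ℝ) ≤ k := by exact_mod_cast le_max_right _ _
  obtain ⟨⟨cx, cy, ct⟩, ⟨cx', cy', ct'⟩, ⟨x, y, t⟩, ⟨x', y', t'⟩, hcz, hcz', hmax, hmin, hval,
    hpen⟩ := hdbl k (le_max_left _ _) g hg hg1
  have hS := hu.2 _ (Tst_contDiff _ _ _ _ _) _ hmax
  have hT := hv.2 _ (Tst_contDiff _ _ _ _ _) _ hmin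
  rw [Tst_pdT, Tst_pdX, Tst_pdY] at hS hT
  obtain ⟨hcx, hcy, hct⟩ := Qd_le_one hcz
  obtain ⟨hcx', hcy', hct'⟩ := Qd_le_one hcz'
  have hv0 := hval z0
  dsimp only at hS hT hcx hcy hct hcx' hcy' hct' hpen
  generalize hPx : (2 * (k : ℝ)) • (x - x') + (2 * g) • (x - cx) = Px at hS
  generalize hPy : 2 * b * (y - y') + 2 * g * (y - cy) = Py at hS
  generalize hPx' : (2 * -(k : ℝ)) • (x' - x) + (2 * -g) • (x' - cx') = Px' at hT
  generalize hPy' : 2 * -b * (y' - y) + 2 * -g * (y' - cy') = Py' at hT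
  set s : ℝ := |y - y'| with hs
  set r : ℝ := |t - t'| with hr
  have hs0 : 0 ≤ s := abs_nonneg _
  have hr0 : 0 ≤ r := abs_nonneg _
  have hpen' : b * (s ^ 2 + r ^ 2) ≤ τ ^ 2 := by rw [hs, hr, sq_abs, sq_abs]; exact hpen
  have hb0 : 0 < b := by linarith
  obtain ⟨hsτ, hrτ, hbs, hbr, hbsr⟩ := arith_pen hb hτ hτ1 hpen'
  have hg2y : ∀ e : ℝ, |e| ≤ 1 → |2 * g * e| ≤ 2 * g := by
    intro e he
    rw [abs_mul, abs_of_pos (by positivity : 0 < 2 * g)]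
    exact mul_le_of_le_one_right (by positivity) he
  have hPyb : |Py| ≤ 2 * b * s + 1 := by
    rw [← hPy]
    refine (abs_add_le _ _).trans ?_
    have e1 : |2 * b * (y - y')| = 2 * b * s := by
      rw [abs_mul, abs_of_pos (by positivity : 0 < 2 * b)]
    rw [e1]
    linarith [hg2y _ hcy]
  have hpt : |2 * b * (t - t')| = 2 * b * r := by
    rw [abs_mul, abs_of_pos (by positivity : 0 < 2 * b)]
  have het := abs_le.mp (hg2y _ hct)
  have het' := abs_le.mp (hg2y _ hct')
  have hpt' := abs_le.mp hpt.le
  have hGup : G x y t Px Py ≤ K0 + 1 + 2 * b * r := by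
    have hau : -(α * Mu) ≤ α * u (x, y, t) := by
      have := mul_le_mul_of_nonneg_left (abs_le.mp (hMu (x, y, t))).1 hα
      linarith
    have := le_abs_self A
    linarith [het.1, hpt'.1]
  have hPxR : ‖Px‖ ≤ R := Px_bound h1 ⟨hC1, hC2, hco⟩ h3 x y t Px Py hb (hsτ.trans hτ1)
    (hrτ.trans hτ1) hPyb hGup
  have hPyR : |Py| ≤ 2 * b + 1 := by
    have : b * s ≤ b * 1 := mul_le_mul_of_nonneg_left (hsτ.trans hτ1) hb0.le
    linarith
  have hxx : ‖x - x'‖ < ρ := by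
    have e1 : (2 * (k : ℝ)) • (x - x') = Px - (2 * g) • (x - cx) := by rw [← hPx]; abel
    have e2 : ‖(2 * (k : ℝ)) • (x - x')‖ ≤ R + 1 := by
      rw [e1]
      refine (norm_sub_le _ _).trans ?_
      rw [norm_smul, Real.norm_eq_abs, abs_of_pos (by positivity : 0 < 2 * g)]
      linarith [mul_le_of_le_one_right (by positivity : 0 ≤ 2 * g) hcx]
    rw [norm_smul, Real.norm_eq_abs, abs_of_nonneg (by positivity : 0 ≤ 2 * (k : ℝ))] at e2
    by_contra hcon
    push Not at hcon
    have hk1' : (k1 : ℝ) * ρ ≤ k * ρ := by gcongr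
    have : (k : ℝ) * ρ ≤ k * ‖x - x'‖ := by gcongr
    have : 0 ≤ (k : ℝ) * ‖x - x'‖ := by positivity
    linarith
  have hdPx : ‖Px - Px'‖ < ρ := by
    have e1 : Px - Px' = (2 * g) • (x - cx) + (2 * g) • (x' - cx') := by
      rw [← hPx, ← hPx']; module
    rw [e1]
    refine (norm_add_le _ _).trans_lt ?_
    rw [norm_smul, norm_smul, Real.norm_eq_abs, abs_of_pos (by positivity : 0 < 2 * g)]
    linarith [mul_le_of_le_one_right (by positivity : 0 ≤ 2 * g) hcx,
      mul_le_of_le_one_right (by positivity : 0 ≤ 2 * g) hcx']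
  have hdPy : |Py - Py'| < ρ := by
    have e1 : Py - Py' = 2 * g * (y - cy) + 2 * g * (y' - cy') := by
      rw [← hPy, ← hPy']; ring
    rw [e1]
    refine (abs_add_le _ _).trans_lt ?_
    linarith [hg2y _ hcy, hg2y _ hcy']
  have c1 := (abs_le.mp (hunif x x' y' t' Px Px' Py Py' (hPxR.trans (le_max_left _ _))
    (hPyR.trans (le_max_right _ _)) hxx hdPx hdPy)).1
  have c2 := G_chain h1 ⟨hC1, hC2, hco⟩ h3 x y y' t t' Px Py hb hK0n hτ hτ1 hτC hs hr hpen'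
    hPyb hGup
  rw [← hK] at c2
  have hGG : G x' y' t' Px' Py' ≤ G x y t Px Py + (1 + K) * τ := by linarith
  have hval' := mul_le_mul_of_nonneg_left hv0 hα
  linarith [het.1, het.2, het'.1, het'.2]

end Main

/-- Under (H1)–(H3), with λ̄ the ergodic constant and w^α the
continuous space-time periodic viscosity solution of `w_t + G + α w = 0` : for every
δ > 0 there is α₀ > 0 such that for all 0 < α < α₀, w^α is a viscosity subsolution
of `w_t + G = λ̄ + δ` and a viscosity supersolution of `w_t + G = λ̄ - δ`. -/
theorem statement12 {n : ℕ} (hn : 0 < n) (G : Ham n) (C₁ C₂ l C₃ C₄ C₅ : ℝ)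
    (h1 : HypH1 G) (h2 : HypH2 G C₁ C₂) (h3 : HypH3 G l C₃ C₄ C₅)
    (lam : ℝ) (hlam : ErgodicConst G lam)
    (w : ℝ → Dom n → ℝ)
    (hw : ∀ α : ℝ, 0 < α → STPeriodic (w α) ∧ ViscSol G α 0 (w α)) :
    ∀ δ : ℝ, 0 < δ → ∃ α₀ : ℝ, 0 < α₀ ∧ ∀ α : ℝ, 0 < α → α < α₀ →
      ViscSub G 0 (lam + δ) (w α) ∧ ViscSuper G 0 (lam - δ) (w α) := by
  intro δ hδ
  obtain ⟨⟨u, hub, hu⟩, ⟨v, hvb, hv⟩⟩ := hlam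
  have hub' := hub
  have hvb' := hvb
  obtain ⟨Mu, hMu⟩ := hub'
  obtain ⟨Mv, hMv⟩ := hvb'
  have hMu0 : 0 ≤ Mu := (abs_nonneg _).trans (hMu 0)
  have hMv0 : 0 ≤ Mv := (abs_nonneg _).trans (hMv 0)
  refine ⟨δ / (2 * (Mu + Mv + 1)), by positivity, fun α hα hα0 => ?_⟩
  rw [lt_div_iff₀ (by positivity)] at hα0
  obtain ⟨hper, hcont, hsub, hsup⟩ := hw α hα
  have hwb := periodic_bdd hper hcont
  have hu' : ViscSub G α (lam + α * Mu) u := by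
    refine ⟨hu.1, fun φ hφ z hz => ?_⟩
    have e1 := hu.2 φ hφ z hz
    have e2 := mul_le_mul_of_nonneg_left (abs_le.mp (hMu z)).2 hα.le
    linarith
  have hv' : ViscSuper G α (lam - α * Mv) v := by
    refine ⟨hv.1, fun φ hφ z hz => ?_⟩
    have e1 := hv.2 φ hφ z hz
    have e2 := mul_le_mul_of_nonneg_left (abs_le.mp (hMv z)).1 hα.le
    linarith
  have hαu : 0 ≤ α * Mu := by positivity
  have hαv : 0 ≤ α * Mv := by positivity
  constructor
  · refine ⟨hsub.1, fun φ hφ z hz => ?_⟩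
    have e1 := hsub.2 φ hφ z hz
    have e2 := comparison h1 h2 h3 hα.le hub hwb hu' hsup z
    have e3 := mul_le_mul_of_nonneg_left (abs_le.mp (hMu z)).1 hα.le
    linarith
  · refine ⟨hsup.1, fun φ hφ z hz => ?_⟩
    have e1 := hsup.2 φ hφ z hz
    have e2 := comparison h1 h2 h3 hα.le hwb hvb hsub hv' z
    have e3 := mul_le_mul_of_nonneg_left (abs_le.mp (hMv z)).2 hα.le
    linarith
end
end

section
/- Assume (H1)–(H3). Let λ₁, λ₂ ∈ ℝ be such that the equation w_t + G(x,y,t,D_x w, D_y w) = λ₁ on ℝⁿ×ℝ×ℝ admits a bounded upper semicontinuous viscosity subsolution, and the equation w_t + G(x,y,t,D_x w, D_y w) = λ₂ on ℝⁿ×ℝ×ℝ admits a bounded lower semicontinuous viscosity supersolution. Then λ₁ ≥ λ₂. -/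
open MeasureTheory Topology Filter
open scoped RealInnerProductSpace

noncomputable section

section Helpers

lemma aux_lip {f : ℝ → ℝ} (hf : LocallyLipschitz f) {a b C : ℝ}
    (h : ∀ᵐ s, s ∈ Set.uIoc a b → |deriv f s| ≤ C) : |f b - f a| ≤ C * |b - a| := by
  obtain ⟨K, hK⟩ := LocallyLipschitzOn.exists_lipschitzOnWith_of_compact
    (s := Set.uIcc a b) isCompact_uIcc (hf.locallyLipschitzOn.mono (Set.subset_univ _))
  rw [← hK.absolutelyContinuousOnInterval.integral_deriv_eq_sub]
  exact intervalIntegral.norm_integral_le_of_norm_le_const_ae (f := deriv f) h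

lemma aux_exp {f : ℝ → ℝ} (hf : LocallyLipschitz f) {b C D : ℝ} (hC : 0 ≤ C) (hD : 0 ≤ D)
    (h : ∀ᵐ s, |deriv f s| ≤ C * (D + |f s|)) (hb : C * |b| ≤ 1 / 2) :
    |f b - f 0| ≤ 2 * (C * |b|) * (D + |f 0|) := by
  obtain ⟨m, hm, hmax⟩ := (isCompact_uIcc (a := (0:ℝ)) (b := b)).exists_isMaxOn
    Set.nonempty_uIcc (hf.continuous.abs.continuousOn)
  have key : ∀ c ∈ Set.uIcc 0 b, |f c - f 0| ≤ C * |b| * (D + |f m|) := by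
    intro c hc
    have h1 : |f c - f 0| ≤ C * (D + |f m|) * |c - 0| := by
      apply aux_lip hf
      filter_upwards [h] with s hs hs'
      refine hs.trans ?_
      have : s ∈ Set.uIcc 0 b :=
        (Set.uIcc_subset_uIcc Set.left_mem_uIcc hc) (Set.uIoc_subset_uIcc hs')
      have := hmax this
      simp only [Set.mem_ofPred_eq] at this
      gcongr
    have h2 : |c - 0| ≤ |b| := by
      have := Set.abs_sub_left_of_mem_uIcc hc
      simpa using this
    calc _ ≤ _ := h1
      _ ≤ C * (D + |f m|) * |b| := by gcongr
      _ = _ := by ring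
  have hm' := key m hm
  have hb' := key b Set.right_mem_uIcc
  have h3 : |f m| ≤ |f 0| + |f m - f 0| := by
    have := abs_sub_abs_le_abs_sub (f m) (f 0); linarith
  have h0 : 0 ≤ C * |b| := by positivity
  have h4 : D + |f m| ≤ 2 * (D + |f 0|) := by
    have : C * |b| * (D + |f m|) ≤ 1/2 * (D + |f m|) := by gcongr
    linarith
  calc _ ≤ _ := hb'
    _ ≤ C * |b| * (2 * (D + |f 0|)) := by gcongr
    _ = _ := by ring

lemma haar_xi (n : ℕ) : (volume : Measure (Xi n)).IsAddHaarMeasure := by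
  have h1 : ((volume : Measure (Euc n)).prod (volume : Measure ℝ)).IsAddHaarMeasure :=
    inferInstance
  have h2 : ((volume : Measure ℝ).prod
      ((volume : Measure (Euc n)).prod (volume : Measure ℝ))).IsAddHaarMeasure := by
    apply Measure.prod.instIsAddHaarMeasure
  have h3 : ((volume : Measure ℝ).prod ((volume : Measure ℝ).prod
      ((volume : Measure (Euc n)).prod (volume : Measure ℝ)))).IsAddHaarMeasure := by
    apply Measure.prod.instIsAddHaarMeasure
  have h4 : ((volume : Measure (Euc n)).prod
      ((volume : Measure ℝ).prod ((volume : Measure ℝ).prod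
      ((volume : Measure (Euc n)).prod (volume : Measure ℝ))))).IsAddHaarMeasure := by
    apply Measure.prod.instIsAddHaarMeasure
  exact h4

lemma aux_ae {n : ℕ} {p : Xi n → Prop} (h : ∀ᵐ ξ ∂(volume : Measure (Xi n)), p ξ) (e : Xi n) :
    ∀ᵐ ξ ∂(volume : Measure (Xi n)), ∀ᵐ s : ℝ, p (ξ + s • e) := by
  have := haar_xi n
  obtain ⟨S, hS, hSm, hS0⟩ := exists_measurable_superset_of_null h
  have h1 : ∀ᵐ ξ ∂(volume : Measure (Xi n)), ξ ∈ Sᶜ := by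
    rw [ae_iff]; simpa using hS0
  have h2 := (ae_ae_add_linearMap_mem_iff (𝕜 := ℝ) (LinearMap.toSpanSingleton ℝ (Xi n) e)
    (volume : Measure ℝ) (volume : Measure (Xi n)) hSm.compl).2 h1
  filter_upwards [h2] with ξ hξ
  filter_upwards [hξ] with s hs
  by_contra hc
  exact hs (hS hc)

lemma aux_all {n : ℕ} {f g : Xi n → ℝ} (hf : Continuous f) (hg : Continuous g)
    (h : ∀ᵐ ξ ∂(volume : Measure (Xi n)), f ξ ≤ g ξ) (ξ : Xi n) : f ξ ≤ g ξ := by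
  have := haar_xi n
  have hd := Measure.dense_of_ae h
  have hc : IsClosed {x | f x ≤ g x} := isClosed_le hf hg
  have := hc.closure_eq ▸ hd.closure_eq
  have h2 : ξ ∈ {x | f x ≤ g x} := by rw [this]; trivial
  exact h2

lemma lip_y {n : ℕ} {G : Ham n} {l C₃ C₄ C₅ : ℝ} (h1 : HypH1 G) (h3 : HypH3 G l C₃ C₄ C₅)
    (x : Euc n) (y t : ℝ) (px : Euc n) (py : ℝ) (s : ℝ) :
    |G x (y + s) t px py - G x y t px py| ≤ C₃ * |py + l| * |s| := by
  obtain ⟨_, _, _, hl, hae⟩ := h3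
  have hG := h1.1
  refine aux_all (f := fun ξ : Xi n => |G ξ.1 (ξ.2.1 + s) ξ.2.2.1 ξ.2.2.2.1 ξ.2.2.2.2
    - G ξ.1 ξ.2.1 ξ.2.2.1 ξ.2.2.2.1 ξ.2.2.2.2|)
    (g := fun ξ => C₃ * |ξ.2.2.2.2 + l| * |s|) ?_ (by fun_prop) ?_ (x, y, t, px, py)
  · refine (Continuous.sub ?_ hG).abs
    exact hG.comp (f := fun ξ : Xi n => ((ξ.1, ξ.2.1 + s, ξ.2.2.1, ξ.2.2.2.1, ξ.2.2.2.2) : Xi n))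
      (by fun_prop)
  filter_upwards [aux_ae hae (0, 1, 0, 0, 0)] with ξ hξ
  have hL : LocallyLipschitz (fun r => G ξ.1 (ξ.2.1 + r) ξ.2.2.1 ξ.2.2.2.1 ξ.2.2.2.2) := by
    refine LocallyLipschitz.comp (f := fun q : ℝ × ℝ × ℝ => G ξ.1 q.1 q.2.1 ξ.2.2.2.1 q.2.2)
      (g := fun r => (ξ.2.1 + r, ξ.2.2.1, ξ.2.2.2.2)) (hl ξ.1 ξ.2.2.2.1) ?_
    exact ContDiff.locallyLipschitz (𝕂 := ℝ) (by fun_prop)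
  have := aux_lip hL (a := 0) (b := s) (C := C₃ * |ξ.2.2.2.2 + l|) ?_
  · simpa using this
  filter_upwards [hξ] with r hr _
  have := hr.1
  simp only [Prod.fst_add, Prod.snd_add, Prod.smul_fst, Prod.smul_snd, smul_zero, add_zero,
    smul_eq_mul, mul_one, mul_zero] at this
  rw [deriv_comp_const_add (fun y => G ξ.1 y ξ.2.2.1 ξ.2.2.2.1 ξ.2.2.2.2)]
  exact this

lemma lip_py {n : ℕ} {G : Ham n} {l C₃ C₄ C₅ : ℝ} (h1 : HypH1 G) (h3 : HypH3 G l C₃ C₄ C₅)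
    (x : Euc n) (y t : ℝ) (px : Euc n) (py : ℝ) (s : ℝ) :
    |G x y t px (py + s) - G x y t px py| ≤ C₅ * |s| := by
  obtain ⟨_, _, _, hl, hae⟩ := h3
  have hG := h1.1
  refine aux_all (f := fun ξ : Xi n => |G ξ.1 ξ.2.1 ξ.2.2.1 ξ.2.2.2.1 (ξ.2.2.2.2 + s)
    - G ξ.1 ξ.2.1 ξ.2.2.1 ξ.2.2.2.1 ξ.2.2.2.2|)
    (g := fun ξ => C₅ * |s|) ?_ (by fun_prop) ?_ (x, y, t, px, py)
  · refine (Continuous.sub ?_ hG).abs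
    exact hG.comp (f := fun ξ : Xi n => ((ξ.1, ξ.2.1, ξ.2.2.1, ξ.2.2.2.1, ξ.2.2.2.2 + s) : Xi n))
      (by fun_prop)
  filter_upwards [aux_ae hae (0, 0, 0, 0, 1)] with ξ hξ
  have hL : LocallyLipschitz (fun r => G ξ.1 ξ.2.1 ξ.2.2.1 ξ.2.2.2.1 (ξ.2.2.2.2 + r)) := by
    refine LocallyLipschitz.comp (f := fun q : ℝ × ℝ × ℝ => G ξ.1 q.1 q.2.1 ξ.2.2.2.1 q.2.2)
      (g := fun r => (ξ.2.1, ξ.2.2.1, ξ.2.2.2.2 + r)) (hl ξ.1 ξ.2.2.2.1) ?_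
    exact ContDiff.locallyLipschitz (𝕂 := ℝ) (by fun_prop)
  have := aux_lip hL (a := 0) (b := s) (C := C₅) ?_
  · simpa using this
  filter_upwards [hξ] with r hr _
  have := hr.2.2
  simp only [Prod.fst_add, Prod.snd_add, Prod.smul_fst, Prod.smul_snd, smul_zero, add_zero,
    smul_eq_mul, mul_one, mul_zero] at this
  rw [deriv_comp_const_add (fun p => G ξ.1 ξ.2.1 ξ.2.2.1 ξ.2.2.2.1 p)]
  exact this

lemma lip_t {n : ℕ} {G : Ham n} {l C₃ C₄ C₅ : ℝ} (h1 : HypH1 G) (h3 : HypH3 G l C₃ C₄ C₅)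
    (x : Euc n) (y t : ℝ) (px : Euc n) (py : ℝ) (s : ℝ) (hs : C₄ * |s| ≤ 1 / 2) :
    |G x y (t + s) px py - G x y t px py| ≤
      2 * (C₄ * |s|) * (1 + |py| + |G x y t px py|) := by
  obtain ⟨_, h4, _, hl, hae⟩ := h3
  have hG := h1.1
  refine aux_all (f := fun ξ : Xi n => |G ξ.1 ξ.2.1 (ξ.2.2.1 + s) ξ.2.2.2.1 ξ.2.2.2.2
    - G ξ.1 ξ.2.1 ξ.2.2.1 ξ.2.2.2.1 ξ.2.2.2.2|)
    (g := fun ξ => 2 * (C₄ * |s|) * (1 + |ξ.2.2.2.2| +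
      |G ξ.1 ξ.2.1 ξ.2.2.1 ξ.2.2.2.1 ξ.2.2.2.2|)) ?_ (by fun_prop) ?_ (x, y, t, px, py)
  · refine (Continuous.sub ?_ hG).abs
    exact hG.comp (f := fun ξ : Xi n => ((ξ.1, ξ.2.1, ξ.2.2.1 + s, ξ.2.2.2.1, ξ.2.2.2.2) : Xi n))
      (by fun_prop)
  filter_upwards [aux_ae hae (0, 0, 1, 0, 0)] with ξ hξ
  have hL : LocallyLipschitz (fun r => G ξ.1 ξ.2.1 (ξ.2.2.1 + r) ξ.2.2.2.1 ξ.2.2.2.2) := by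
    refine LocallyLipschitz.comp (f := fun q : ℝ × ℝ × ℝ => G ξ.1 q.1 q.2.1 ξ.2.2.2.1 q.2.2)
      (g := fun r => (ξ.2.1, ξ.2.2.1 + r, ξ.2.2.2.2)) (hl ξ.1 ξ.2.2.2.1) ?_
    exact ContDiff.locallyLipschitz (𝕂 := ℝ) (by fun_prop)
  have := aux_exp hL (b := s) (C := C₄) (D := 1 + |ξ.2.2.2.2|) h4 (by positivity) ?_ hs
  · simpa using this
  filter_upwards [hξ] with r hr
  have := hr.2.1
  simp only [Prod.fst_add, Prod.snd_add, Prod.smul_fst, Prod.smul_snd, smul_zero, add_zero,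
    smul_eq_mul, mul_one, mul_zero] at this
  rw [deriv_comp_const_add (fun t => G ξ.1 ξ.2.1 t ξ.2.2.2.1 ξ.2.2.2.2)]
  exact this

/-- uniform continuity from periodicity -/
lemma unif_G {n : ℕ} {G : Ham n} (h1 : HypH1 G) (K ε : ℝ) (hε : 0 < ε) :
    ∃ ρ > 0, ∀ (x x' : Euc n) (y t : ℝ) (p p' : Euc n) (q q' : ℝ),
      ‖x - x'‖ < ρ → ‖p - p'‖ < ρ → |q - q'| < ρ → ‖p‖ ≤ K → |q| ≤ K →
      |G x y t p q - G x' y t p' q'| < ε := by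
  obtain ⟨hG, hx, hy, ht⟩ := h1
  set f : Xi n → ℝ := fun ξ => G ξ.1 ξ.2.1 ξ.2.2.1 ξ.2.2.2.1 ξ.2.2.2.2 with hf
  have hyk : ∀ (k : ℤ) x y t p q, G x (y + k) t p q = G x y t p q := by
    intro k x y t p q
    have : Function.Periodic (fun y => G x y t p q) 1 := fun y => hy x y t p q
    simpa using this.int_mul k y
  have htk : ∀ (k : ℤ) x y t p q, G x y (t + k) p q = G x y t p q := by
    intro k x y t p q
    have : Function.Periodic (fun t => G x y t p q) 1 := fun t => ht x y t p q
    simpa using this.int_mul k t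
  have hK : IsCompact (Metric.closedBall (0 : Xi n) (|K| + n + 2)) := isCompact_closedBall _ _
  have huc := hK.uniformContinuousOn_of_continuous hG.continuousOn
  rw [Metric.uniformContinuousOn_iff] at huc
  obtain ⟨ρ, hρ, H⟩ := huc ε hε
  refine ⟨min ρ 1, by positivity, ?_⟩
  intro x x' y t p p' q q' hxx hpp hqq hp hq
  set k : Fin n → ℤ := fun i => -⌊x i⌋ with hk
  have hnx : ‖x + intVec k‖ ≤ n := by
    have h0 : ∀ i, |(x + intVec k) i| ≤ 1 := by
      intro i
      simp only [intVec, hk, PiLp.add_apply, Int.cast_neg]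
      have := Int.floor_le (x i)
      have := Int.lt_floor_add_one (x i)
      rw [abs_le]; constructor <;> linarith
    have h2 : ‖x + intVec k‖ ^ 2 ≤ (n:ℝ) ^ 2 := by
      rw [EuclideanSpace.norm_sq_eq]
      calc _ ≤ ∑ i : Fin n, (1:ℝ) := by
            apply Finset.sum_le_sum
            intro i _
            have := h0 i
            rw [Real.norm_eq_abs]
            have h := abs_nonneg ((x + intVec k) i)
            nlinarith
        _ = n := by simp
        _ ≤ _ := by exact_mod_cast Nat.le_self_pow (by norm_num) n
    exact le_of_sq_le_sq h2 (by positivity)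
  have habs : ∀ r : ℝ, |r + ((-⌊r⌋ : ℤ):ℝ)| ≤ 1 := by
    intro r
    have := Int.floor_le r
    have := Int.lt_floor_add_one r
    push_cast
    rw [abs_le]; constructor <;> linarith
  have hKa := le_abs_self K
  have hn0 : (0:ℝ) ≤ n := by positivity
  have hK0 := abs_nonneg K
  have hρ1 := min_le_left ρ 1
  have hρ2 := min_le_right ρ 1
  have hmem : ∀ (x0 p0 : Euc n) (q0 : ℝ), ‖x0‖ ≤ n + 1 → ‖p0‖ ≤ |K| + 1 → |q0| ≤ |K| + 1 →
      ((x0, y + ((-⌊y⌋ : ℤ):ℝ), t + ((-⌊t⌋ : ℤ):ℝ), p0, q0) : Xi n) ∈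
        Metric.closedBall (0 : Xi n) (|K| + n + 2) := by
    intro x0 p0 q0 a b c
    rw [mem_closedBall_zero_iff]
    have h1 := habs y
    have h2 := habs t
    simp only [Prod.norm_def, sup_le_iff, Real.norm_eq_abs]
    refine ⟨?_, ?_, ?_, ?_, ?_⟩ <;> linarith
  have e1 : ‖x' + intVec k‖ ≤ n + 1 := by
    have : x' + intVec k = (x + intVec k) - (x - x') := by abel
    rw [this]
    exact (norm_sub_le _ _).trans (by linarith)
  have e2 : ‖p'‖ ≤ |K| + 1 := by
    have : p' = p - (p - p') := by abel
    rw [this]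
    exact (norm_sub_le _ _).trans (by linarith)
  have e3 : |q'| ≤ |K| + 1 := by
    have : q' = q - (q - q') := by ring
    rw [this]
    exact (abs_sub _ _).trans (by linarith)
  have := H _ (hmem (x + intVec k) p q (by linarith) (by linarith) (by linarith))
    _ (hmem (x' + intVec k) p' q' e1 e2 e3) ?_
  · simp only [hf, hx, hyk, htk, Real.dist_eq] at this
    exact this
  · simp only [Prod.dist_eq, dist_self, sup_lt_iff]
    refine ⟨?_, hρ, hρ, ?_, ?_⟩
    · rw [dist_eq_norm]; simp only [add_sub_add_right_eq_sub]; linarith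
    · rw [dist_eq_norm]; linarith
    · rw [Real.dist_eq]; linarith

/-- doubling penalty -/
def Qpen {n : ℕ} (A B : ℝ) (w z : Dom n) : ℝ :=
  A * ((w.2.1 - z.2.1) ^ 2 + (w.2.2 - z.2.2) ^ 2) + B * ‖w.1 - z.1‖ ^ 2

/-- localization -/
def Nloc {n : ℕ} (w : Dom n) : ℝ := ‖w.1‖ ^ 2 + w.2.1 ^ 2 + w.2.2 ^ 2

lemma Nloc_nonneg {n : ℕ} (w : Dom n) : 0 ≤ Nloc w := by unfold Nloc; positivity

lemma test_contDiff {n : ℕ} (A B κ : ℝ) (z : Dom n) :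
    ContDiff ℝ 1 (fun w : Dom n => Qpen A B w z + κ * Nloc w) := by
  unfold Qpen Nloc
  have h1 : ContDiff ℝ 1 (fun w : Dom n => ‖w.1 - z.1‖ ^ 2) :=
    ContDiff.norm_sq ℝ (by fun_prop)
  have h2 : ContDiff ℝ 1 (fun w : Dom n => ‖w.1‖ ^ 2) :=
    ContDiff.norm_sq ℝ (by fun_prop)
  fun_prop

lemma test_fderiv {n : ℕ} (A B κ : ℝ) (z w e : Dom n) :
    fderiv ℝ (fun w : Dom n => Qpen A B w z + κ * Nloc w) w e =
      2 * A * ((w.2.1 - z.2.1) * e.2.1 + (w.2.2 - z.2.2) * e.2.2)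
      + 2 * B * inner ℝ (w.1 - z.1) e.1
      + 2 * κ * (inner ℝ w.1 e.1 + w.2.1 * e.2.1 + w.2.2 * e.2.2) := by
  have hx : HasFDerivAt (fun w : Dom n => w.1) (ContinuousLinearMap.fst ℝ (Euc n) (ℝ × ℝ)) w :=
    hasFDerivAt_fst
  have hyt : HasFDerivAt (fun w : Dom n => w.2) (ContinuousLinearMap.snd ℝ (Euc n) (ℝ × ℝ)) w :=
    hasFDerivAt_snd
  have hy : HasFDerivAt (fun w : Dom n => w.2.1) _ w := hyt.fst
  have ht : HasFDerivAt (fun w : Dom n => w.2.2) _ w := hyt.snd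
  have H := (((((hy.sub_const z.2.1).pow 2).add ((ht.sub_const z.2.2).pow 2)).const_mul A).add
    (((hx.sub_const z.1).norm_sq).const_mul B)).add
    (((hx.norm_sq.add (hy.pow 2)).add (ht.pow 2)).const_mul κ)
  have H2 : HasFDerivAt (fun w : Dom n => Qpen A B w z + κ * Nloc w) _ w := H
  rw [H2.fderiv]
  simp [inner_sub_left]
  ring

lemma test_pdT {n : ℕ} (A B κ : ℝ) (z w : Dom n) :
    pdT (fun w : Dom n => Qpen A B w z + κ * Nloc w) w =
      2 * A * (w.2.2 - z.2.2) + 2 * κ * w.2.2 := by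
  unfold pdT; rw [test_fderiv]; simp

lemma test_pdY {n : ℕ} (A B κ : ℝ) (z w : Dom n) :
    pdY (fun w : Dom n => Qpen A B w z + κ * Nloc w) w =
      2 * A * (w.2.1 - z.2.1) + 2 * κ * w.2.1 := by
  unfold pdY; rw [test_fderiv]; simp

lemma test_pdX {n : ℕ} (A B κ : ℝ) (z w : Dom n) :
    pdX (fun w : Dom n => Qpen A B w z + κ * Nloc w) w =
      (2 * B) • (w.1 - z.1) + (2 * κ) • w.1 := by
  unfold pdX
  ext i
  simp only [test_fderiv, EuclideanSpace.inner_single_right]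
  simp

lemma two_seq (f : ℕ → ℕ → ℝ) (c : ℝ) (hc : ∀ k j, c ≤ f k j)
    (h1 : ∀ k k' j, k ≤ k' → f k' j ≤ f k j) (h2 : ∀ k j j', j ≤ j' → f k j' ≤ f k j)
    (η : ℝ) (hη : 0 < η) : ∃ k N, ∀ j ≥ N, f k j - f (k + 1) j ≤ η := by
  have hb : ∀ k, BddBelow (Set.range (f k)) := fun k => ⟨c, by rintro _ ⟨j, rfl⟩; exact hc k j⟩
  set g : ℕ → ℝ := fun k => ⨅ j, f k j with hg
  have hgc : ∀ k, c ≤ g k := fun k => le_ciInf (hc k)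
  have hganti : Antitone g := by
    intro k k' hk
    exact ciInf_mono (hb k') (fun j => h1 k k' j hk)
  have hgt := tendsto_atTop_ciInf hganti ⟨c, by rintro _ ⟨k, rfl⟩; exact hgc k⟩
  have hgt2 := (hgt.sub (hgt.comp (tendsto_add_atTop_nat 1)))
  rw [sub_self] at hgt2
  obtain ⟨k, hk⟩ := (hgt2.eventually (gt_mem_nhds (half_pos hη))).exists
  obtain ⟨N, hN⟩ := exists_lt_of_ciInf_lt (show (⨅ j, f k j) < g k + η / 2 by
    simp only [hg]; linarith)
  refine ⟨k, N, fun j hj => ?_⟩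
  have a1 := h2 k N j hj
  have a2 : g (k + 1) ≤ f (k + 1) j := ciInf_le (hb (k + 1)) j
  simp only [Function.comp] at hk
  linarith

lemma exists_max {n : ℕ} {u v : Dom n → ℝ} (hu : UpperSemicontinuous u)
    (hv : LowerSemicontinuous v) {M : ℝ} (hM : ∀ z, |u z| ≤ M) (hM' : ∀ z, |v z| ≤ M)
    {A B κ : ℝ} (hκ : 0 < κ) (hκ1 : κ ≤ 1) (hA : 1 ≤ A) (hB : 1 ≤ B) :
    ∃ z z' : Dom n, ∀ w w', u w - v w' - Qpen A B w w' - κ * Nloc w ≤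
      u z - v z' - Qpen A B z z' - κ * Nloc z := by
  set Ψ : Dom n × Dom n → ℝ := fun p => u p.1 - v p.2 - Qpen A B p.1 p.2 - κ * Nloc p.1 with hΨ
  have husc : UpperSemicontinuous Ψ := by
    have e : Ψ = fun p => (u p.1 + (-v p.2)) + (- Qpen A B p.1 p.2 - κ * Nloc p.1) := by
      ext p; simp only [hΨ]; ring
    rw [e]
    refine UpperSemicontinuous.add (UpperSemicontinuous.add ?_ ?_) ?_
    · intro p y hy
      exact continuousAt_fst.eventually ((hu p.1) y hy)
    · intro p y hy
      have := (hv p.2) (-y) (by linarith)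
      have := continuousAt_snd.eventually this
      filter_upwards [this] with q hq
      linarith
    · apply Continuous.upperSemicontinuous
      unfold Qpen Nloc
      fun_prop
  set r := Real.sqrt (4 * M / κ) with hr
  have hM0 : 0 ≤ M := (abs_nonneg _).trans (hM 0)
  have hr0 : 0 ≤ r := Real.sqrt_nonneg _
  have hr2 : r ^ 2 = 4 * M / κ := Real.sq_sqrt (by positivity)
  obtain ⟨p, -, hp⟩ := UpperSemicontinuousOn.exists_isMaxOn (s := Metric.closedBall 0 (2 * r))
    (f := Ψ) ⟨0, by simp [hr0]⟩ (isCompact_closedBall _ _) (husc.upperSemicontinuousOn _)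
  refine ⟨p.1, p.2, fun w w' => ?_⟩
  have h00 : Ψ 0 ≤ Ψ p := hp (by simp [hr0])
  by_cases hw : (w, w') ∈ Metric.closedBall (0 : Dom n × Dom n) (2 * r)
  · exact hp hw
  · refine le_trans ?_ h00
    have hz : -(2 * M) ≤ Ψ 0 := by
      have a := abs_le.1 (hM 0)
      have b := abs_le.1 (hM' 0)
      simp only [hΨ, Qpen, Nloc, Prod.fst_zero, Prod.snd_zero]
      simp
      linarith [a.1, b.2]
    refine le_trans ?_ hz
    have a := abs_le.1 (hM w)
    have b := abs_le.1 (hM' w')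
    by_contra hcon
    push Not at hcon
    have hQ : Qpen A B w w' + κ * Nloc w ≤ 4 * M := by linarith [a.2, b.1]
    apply hw
    have hsq : (w.2.1 - w'.2.1) ^ 2 + (w.2.2 - w'.2.2) ^ 2 + ‖w.1 - w'.1‖ ^ 2 +
        (‖w.1‖ ^ 2 + w.2.1 ^ 2 + w.2.2 ^ 2) ≤ r ^ 2 := by
      rw [hr2, le_div_iff₀ hκ]
      refine le_trans ?_ hQ
      unfold Qpen Nloc
      have i1 : κ * ((w.2.1 - w'.2.1) ^ 2 + (w.2.2 - w'.2.2) ^ 2) ≤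
        A * ((w.2.1 - w'.2.1) ^ 2 + (w.2.2 - w'.2.2) ^ 2) := by gcongr; linarith
      have i2 : κ * ‖w.1 - w'.1‖ ^ 2 ≤ B * ‖w.1 - w'.1‖ ^ 2 := by gcongr; linarith
      linarith
    have s1 := sq_nonneg (w.2.1 - w'.2.1)
    have s2 := sq_nonneg (w.2.2 - w'.2.2)
    have s3 := sq_nonneg (‖w.1 - w'.1‖)
    have s4 := sq_nonneg (‖w.1‖)
    have s5 := sq_nonneg (w.2.1)
    have s6 := sq_nonneg (w.2.2)
    have t1 : |w.2.1 - w'.2.1| ≤ r := abs_le_of_sq_le_sq (by linarith) hr0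
    have t2 : |w.2.2 - w'.2.2| ≤ r := abs_le_of_sq_le_sq (by linarith) hr0
    have t3 : ‖w.1 - w'.1‖ ≤ r := le_of_sq_le_sq (by linarith) hr0
    have t4 : ‖w.1‖ ≤ r := le_of_sq_le_sq (by linarith) hr0
    have t5 : |w.2.1| ≤ r := abs_le_of_sq_le_sq (by linarith) hr0
    have t6 : |w.2.2| ≤ r := abs_le_of_sq_le_sq (by linarith) hr0
    have t7 : ‖w'.1‖ ≤ 2 * r := by
      have : w'.1 = w.1 - (w.1 - w'.1) := by abel
      rw [this]; exact (norm_sub_le _ _).trans (by linarith)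
    have t8 : |w'.2.1| ≤ 2 * r := by
      have : w'.2.1 = w.2.1 - (w.2.1 - w'.2.1) := by ring
      rw [this]; exact (abs_sub _ _).trans (by linarith)
    have t9 : |w'.2.2| ≤ 2 * r := by
      have : w'.2.2 = w.2.2 - (w.2.2 - w'.2.2) := by ring
      rw [this]; exact (abs_sub _ _).trans (by linarith)
    rw [mem_closedBall_zero_iff]
    simp only [Prod.norm_def, sup_le_iff, Real.norm_eq_abs]
    refine ⟨⟨?_, ?_, ?_⟩, ?_, ?_, ?_⟩ <;> linarith

lemma final_num {A a b s lam₁ lam₂ qt kt qy py l C₂ C₃ C₄ C₅ G0 G1 G2 G3 : ℝ}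
    (hC₂ : 0 ≤ C₂) (hC₃ : 0 ≤ C₃) (hC₄ : 0 ≤ C₄) (hC₅ : 0 ≤ C₅) (hs0 : 0 < s) (hs1 : s ≤ 1)
    (ha : 0 ≤ a) (hb : 0 ≤ b) (has : a ≤ s) (hbs : b ≤ s) (hA : 1 ≤ A)
    (haa : A * a ^ 2 ≤ s ^ 2) (hbb : A * b ^ 2 ≤ s ^ 2)
    (hqt : |qt| = 2 * A * b) (hqy : |qy| = 2 * A * a) (hkt : |kt| ≤ s) (hpy : |py| ≤ 2 * A * a + s)
    (h0 : qt + kt + G0 ≤ lam₁) (h0' : - C₂ - C₅ * |py| ≤ G0) (h01 : |G0 - G1| ≤ s)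
    (h12 : |G2 - G1| ≤ C₃ * |qy + l| * a)
    (h23 : |G3 - G2| ≤ 2 * (C₄ * b) * (1 + |qy| + |G2|))
    (h3 : lam₂ ≤ qt + G3) :
    lam₂ - lam₁ ≤ s * (2 + C₃ * (2 + |l|) +
      2 * C₄ * (7 + |lam₁| + C₂ + 3 * C₅ + C₃ * (2 + |l|))) := by
  have hss : s ^ 2 ≤ s := by nlinarith
  have hab : A * a * b ≤ s ^ 2 := by nlinarith [sq_nonneg (a - b), mul_nonneg (by linarith : 0 ≤ A) (sq_nonneg (a - b))]
  have hl0 := abs_nonneg l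
  have e2 : C₃ * |qy + l| * a ≤ s * (C₃ * (2 + |l|)) := by
    have : |qy + l| ≤ 2 * A * a + |l| := by rw [← hqy]; exact abs_add_le _ _
    have h' : |qy + l| * a ≤ s * (2 + |l|) := by
      calc _ ≤ (2 * A * a + |l|) * a := by gcongr
        _ = 2 * (A * a ^ 2) + |l| * a := by ring
        _ ≤ 2 * s + |l| * s := by gcongr; linarith
        _ = _ := by ring
    calc _ = C₃ * (|qy + l| * a) := by ring
      _ ≤ C₃ * (s * (2 + |l|)) := by gcongr
      _ = _ := by ring
  have hD0 : 0 ≤ C₃ * (2 + |l|) := by positivity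
  have e2' : s * (C₃ * (2 + |l|)) ≤ C₃ * (2 + |l|) := by nlinarith
  have hG0 : |G0| ≤ |lam₁| + 2 * A * b + 1 + C₂ + C₅ * (2 * A * a + 1) := by
    have hh : C₅ * |py| ≤ C₅ * (2 * A * a + 1) := by gcongr; linarith
    have hAb : 0 ≤ 2 * A * b := by positivity
    have hAa : 0 ≤ C₅ * (2 * A * a + 1) := by positivity
    have := abs_nonneg lam₁
    have := le_abs_self lam₁
    have h6 := neg_abs_le qt
    have h7 := neg_abs_le kt
    rw [abs_le]; constructor <;> linarith
  have hG2 : |G2| ≤ |G0| + 1 + C₃ * (2 + |l|) := by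
    have i1 : |G2| ≤ |G0| + |G0 - G1| + |G2 - G1| := by
      have : G2 = G0 - (G0 - G1) + (G2 - G1) := by ring
      calc |G2| = |G0 - (G0 - G1) + (G2 - G1)| := by rw [← this]
        _ ≤ |G0 - (G0 - G1)| + |G2 - G1| := abs_add_le _ _
        _ ≤ _ := by gcongr; exact abs_sub _ _
    linarith
  have e3 : b * (1 + |qy| + |G2|) ≤ s * (7 + |lam₁| + C₂ + 3 * C₅ + C₃ * (2 + |l|)) := by
    set D := 3 + |lam₁| + C₂ + C₅ + C₃ * (2 + |l|) with hD
    have hD0 : 0 ≤ D := by positivity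
    calc b * (1 + |qy| + |G2|) ≤ b * (D + 2 * A * b + (2 + 2 * C₅) * (A * a)) := by
          apply mul_le_mul_of_nonneg_left _ hb; rw [hqy, hD]; linarith
      _ = b * D + 2 * (A * b ^ 2) + (2 + 2 * C₅) * (A * a * b) := by ring
      _ ≤ s * D + 2 * s + (2 + 2 * C₅) * s := by gcongr <;> linarith
      _ = _ := by rw [hD]; ring
  have e3' : 2 * (C₄ * b) * (1 + |qy| + |G2|) ≤
      2 * C₄ * (s * (7 + |lam₁| + C₂ + 3 * C₅ + C₃ * (2 + |l|))) := by
    calc _ = 2 * C₄ * (b * (1 + |qy| + |G2|)) := by ring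
      _ ≤ _ := by gcongr
  have f1 := (abs_le.1 h01).1
  have f2 := (abs_le.1 h12).2
  have f3 := (abs_le.1 h23).2
  have f4 := (abs_le.1 hkt).1
  linarith

lemma Qpen_symm {n : ℕ} (A B : ℝ) (w z : Dom n) : Qpen A B w z = Qpen A B z w := by
  unfold Qpen; rw [norm_sub_rev]; ring

lemma Qpen_nonneg {n : ℕ} {A B : ℝ} (hA : 0 ≤ A) (hB : 0 ≤ B) (w z : Dom n) :
    0 ≤ Qpen A B w z := by
  unfold Qpen; positivity

lemma Qpen_mono {n : ℕ} {A B A' B' : ℝ} (hA : A ≤ A') (hB : B ≤ B') (w z : Dom n) :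
    Qpen A B w z ≤ Qpen A' B' w z := by
  unfold Qpen; gcongr

set_option maxHeartbeats 2000000 in
lemma main_aux {n : ℕ} (G : Ham n) (C₁ C₂ l C₃ C₄ C₅ : ℝ)
    (h1 : HypH1 G) (h2 : HypH2 G C₁ C₂) (h3 : HypH3 G l C₃ C₄ C₅)
    (lam₁ lam₂ : ℝ) (u v : Dom n → ℝ) (M : ℝ) (hM : ∀ z, |u z| ≤ M) (hM' : ∀ z, |v z| ≤ M)
    (hu : ViscSub G 0 lam₁ u) (hv : ViscSuper G 0 lam₂ v)
    (s : ℝ) (hs0 : 0 < s) (hs1 : s ≤ 1) (hs4 : C₄ * s ≤ 1 / 2) :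
    lam₂ - lam₁ ≤ s * (2 + C₃ * (2 + |l|) +
      2 * C₄ * (7 + |lam₁| + C₂ + 3 * C₅ + C₃ * (2 + |l|))) := by
  obtain ⟨hC₁, hC₂, hco⟩ := h2
  have hC₃ := h3.1
  have hC₄ := h3.2.1
  have hC₅ := h3.2.2.1
  have hM0 : 0 ≤ M := (abs_nonneg _).trans (hM 0)
  set η := s ^ 2 / 4 with hη
  have hη0 : 0 < η := by positivity
  -- the values of the doubled problem
  set Φ : ℕ → ℕ → Dom n × Dom n → ℝ :=
    fun k j p => u p.1 - v p.2 - Qpen (2 ^ k) ((j : ℝ) + 1) p.1 p.2 with hΦ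
  have hΦle : ∀ k j p, Φ k j p ≤ 2 * M := by
    intro k j p
    have a := (abs_le.1 (hM p.1)).2
    have b := (abs_le.1 (hM' p.2)).1
    have c := Qpen_nonneg (n := n) (A := 2 ^ k) (B := (j : ℝ) + 1) (by positivity)
      (by positivity) p.1 p.2
    simp only [hΦ]; linarith
  have hbdd : ∀ k j, BddAbove (Set.range (Φ k j)) := fun k j =>
    ⟨2 * M, by rintro _ ⟨p, rfl⟩; exact hΦle k j p⟩
  have hΦanti : ∀ k k' j j', k ≤ k' → j ≤ j' → ∀ p, Φ k' j' p ≤ Φ k j p := by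
    intro k k' j j' hk hj p
    have : Qpen (2 ^ k) ((j : ℝ) + 1) p.1 p.2 ≤ Qpen (2 ^ k') ((j' : ℝ) + 1) p.1 p.2 := by
      apply Qpen_mono
      · exact pow_le_pow_right₀ (by norm_num) hk
      · have : (j : ℝ) ≤ j' := by exact_mod_cast hj
        linarith
    simp only [hΦ]; linarith
  obtain ⟨k, N, hkN⟩ := two_seq (fun k j => ⨆ p, Φ k j p) (-(2 * M))
    (by
      intro k j
      refine le_trans ?_ (le_ciSup (hbdd k j) 0)
      have a := (abs_le.1 (hM 0)).1
      have b := (abs_le.1 (hM' 0)).2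
      simp only [hΦ, Qpen, Prod.fst_zero, Prod.snd_zero]
      simp
      linarith)
    (fun k k' j hk => ciSup_mono (hbdd k j) (hΦanti k k' j j hk le_rfl))
    (fun k j j' hj => ciSup_mono (hbdd k j) (hΦanti k k j j' le_rfl hj)) η hη0
  set A : ℝ := 2 ^ (k + 1) with hAdef
  have hA1 : 1 ≤ A := one_le_pow₀ (by norm_num)
  have hA0 : 0 < A := by linarith
  set K : ℝ := (|lam₁| + C₂ + C₅ * (2 * A * s + 1) + 2 * A * s + 1) / C₁ + 2 * A * s + 1 with hK
  obtain ⟨ρ, hρ, Hρ⟩ := unif_G h1 K s hs0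
  obtain ⟨j0, hj0⟩ := exists_nat_gt ((4 * M + 1) / ρ ^ 2)
  set j := max N j0 with hj
  set B : ℝ := (j : ℝ) + 1 with hBdef
  have hB1 : 1 ≤ B := by rw [hBdef]; linarith [Nat.cast_nonneg (α := ℝ) j]
  have hBρ : 4 * M + 1 < B * ρ ^ 2 := by
    rw [div_lt_iff₀ (by positivity)] at hj0
    have : (j0 : ℝ) ≤ j := by exact_mod_cast le_max_right _ _
    refine hj0.trans_le ?_
    gcongr; linarith
  have hkj := hkN j (le_max_left _ _)
  obtain ⟨p0, hp0⟩ := exists_lt_of_lt_ciSup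
    (show (⨆ p, Φ (k + 1) j p) - η / 2 < ⨆ p, Φ (k + 1) j p by linarith)
  set r := min ρ s with hr
  have hr0 : 0 < r := lt_min hρ hs0
  have hN0 := Nloc_nonneg p0.1
  obtain ⟨κ, hκ0, hκ1, hκ2, hκ3⟩ : ∃ κ : ℝ, 0 < κ ∧ κ ≤ 1 ∧ κ * Nloc p0.1 ≤ η / 2 ∧
      16 * M * κ < r ^ 2 := by
    refine ⟨min 1 (min (η / 2 / (Nloc p0.1 + 1)) (r ^ 2 / (16 * M + 1))), by positivity,
      min_le_left _ _, ?_, ?_⟩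
    · have : min 1 (min (η / 2 / (Nloc p0.1 + 1)) (r ^ 2 / (16 * M + 1))) ≤
        η / 2 / (Nloc p0.1 + 1) := (min_le_right _ _).trans (min_le_left _ _)
      rw [le_div_iff₀ (by positivity)] at this
      have h' : 0 < min 1 (min (η / 2 / (Nloc p0.1 + 1)) (r ^ 2 / (16 * M + 1))) := by positivity
      linarith
    · have : min 1 (min (η / 2 / (Nloc p0.1 + 1)) (r ^ 2 / (16 * M + 1))) ≤
        r ^ 2 / (16 * M + 1) := (min_le_right _ _).trans (min_le_right _ _)
      rw [le_div_iff₀ (by positivity)] at this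
      have h' : 0 < min 1 (min (η / 2 / (Nloc p0.1 + 1)) (r ^ 2 / (16 * M + 1))) := by positivity
      linarith
  obtain ⟨z, z', hmax⟩ := exists_max hu.1 hv.1 hM hM' hκ0 hκ1 hA1 hB1
  have hQ0 := Qpen_nonneg hA0.le (by linarith : (0:ℝ) ≤ B) z z'
  have hNz := Nloc_nonneg z
  have hκN : 0 ≤ κ * Nloc z := by positivity
  -- penalties are bounded
  have hQM : Qpen A B z z' + κ * Nloc z ≤ 4 * M := by
    have := hmax 0 0
    have a := (abs_le.1 (hM 0)).1
    have b := (abs_le.1 (hM' 0)).2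
    have c := (abs_le.1 (hM z)).2
    have d := (abs_le.1 (hM' z')).1
    have e : Qpen A B (0 : Dom n) 0 = 0 := by simp [Qpen]
    have f : Nloc (0 : Dom n) = 0 := by simp [Nloc]
    rw [e, f] at this
    linarith
  -- small doubling penalty
  have hsmall : A * ((z.2.1 - z'.2.1) ^ 2 + (z.2.2 - z'.2.2) ^ 2) ≤ s ^ 2 := by
    have a1 := hmax p0.1 p0.2
    have a2 : Φ k j (z, z') ≤ ⨆ p, Φ k j p := le_ciSup (hbdd k j) _
    have a3 : Φ k j (z, z') = u z - v z' - Qpen A B z z' +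
        A / 2 * ((z.2.1 - z'.2.1) ^ 2 + (z.2.2 - z'.2.2) ^ 2) := by
      simp only [hΦ, Qpen, hAdef, hBdef]; ring
    have a4 : Φ (k + 1) j p0 = u p0.1 - v p0.2 - Qpen A B p0.1 p0.2 := rfl
    rw [a3] at a2
    rw [a4] at hp0
    linarith
  set a := |z.2.1 - z'.2.1| with ha
  set b := |z.2.2 - z'.2.2| with hb
  have ha0 : 0 ≤ a := abs_nonneg _
  have hb0 : 0 ≤ b := abs_nonneg _
  rw [← sq_abs (z.2.1 - z'.2.1), ← sq_abs (z.2.2 - z'.2.2), ← ha, ← hb] at hsmall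
  have haa : A * a ^ 2 ≤ s ^ 2 := by nlinarith [mul_nonneg hA0.le (sq_nonneg b)]
  have hbb : A * b ^ 2 ≤ s ^ 2 := by nlinarith [mul_nonneg hA0.le (sq_nonneg a)]
  have has : a ≤ s := le_of_sq_le_sq (by nlinarith [sq_nonneg a]) hs0.le
  have hbs : b ≤ s := le_of_sq_le_sq (by nlinarith [sq_nonneg b]) hs0.le
  have hxx : ‖z.1 - z'.1‖ < ρ := by
    refine lt_of_pow_lt_pow_left₀ 2 hρ.le ?_
    have : B * ‖z.1 - z'.1‖ ^ 2 < B * ρ ^ 2 := by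
      have : B * ‖z.1 - z'.1‖ ^ 2 ≤ Qpen A B z z' := by
        unfold Qpen
        have : 0 ≤ A * ((z.2.1 - z'.2.1) ^ 2 + (z.2.2 - z'.2.2) ^ 2) := by positivity
        linarith
      linarith
    exact lt_of_mul_lt_mul_left this (by linarith)
  -- localization gradients are small
  have hloc : ∀ c : ℝ, c ^ 2 ≤ Nloc z → 2 * κ * c < r := by
    intro c hc
    refine lt_of_pow_lt_pow_left₀ 2 hr0.le ?_
    calc (2 * κ * c) ^ 2 = 4 * κ * (κ * c ^ 2) := by ring
      _ ≤ 4 * κ * (κ * Nloc z) := by gcongr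
      _ ≤ 4 * κ * (4 * M) := mul_le_mul_of_nonneg_left (by linarith) (by positivity)
      _ = 16 * M * κ := by ring
      _ < r ^ 2 := hκ3
  have hlx : ‖(2 * κ) • z.1‖ < r := by
    rw [norm_smul, Real.norm_of_nonneg (by positivity)]
    apply hloc; unfold Nloc; nlinarith [sq_nonneg z.2.1, sq_nonneg z.2.2]
  have hly : |2 * κ * z.2.1| < r := by
    rw [abs_mul, abs_of_nonneg (by positivity : 0 ≤ 2 * κ)]
    apply hloc; unfold Nloc; rw [sq_abs]; nlinarith [sq_nonneg ‖z.1‖, sq_nonneg z.2.2]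
  have hlt : |2 * κ * z.2.2| < r := by
    rw [abs_mul, abs_of_nonneg (by positivity : 0 ≤ 2 * κ)]
    apply hloc; unfold Nloc; rw [sq_abs]; nlinarith [sq_nonneg ‖z.1‖, sq_nonneg z.2.1]
  have hrs : r ≤ s := min_le_right _ _
  have hrρ : r ≤ ρ := min_le_left _ _
  -- viscosity inequalities
  have hsub := hu.2 _ (test_contDiff A B κ z') z (by
    refine Filter.Eventually.of_forall fun w => ?_
    have := hmax w z'
    simp only
    linarith)
  have hsup := hv.2 _ (test_contDiff (-A) (-B) 0 z) z' (by
    refine Filter.Eventually.of_forall fun w => ?_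
    have := hmax z w
    have e1 : ∀ w, Qpen (-A) (-B) w z = - Qpen A B z w := by
      intro w; rw [Qpen_symm A B]; unfold Qpen; ring
    simp only [e1]
    linarith)
  rw [test_pdT, test_pdX, test_pdY] at hsub hsup
  set qx : Euc n := (2 * B) • (z.1 - z'.1) with hqx
  set qy : ℝ := 2 * A * (z.2.1 - z'.2.1) with hqy
  set qt : ℝ := 2 * A * (z.2.2 - z'.2.2) with hqt
  have ex : (2 * -B) • (z'.1 - z.1) + (2 * (0:ℝ)) • z'.1 = qx := by
    rw [hqx]; module
  have ey : 2 * -A * (z'.2.1 - z.2.1) + 2 * 0 * z'.2.1 = qy := by rw [hqy]; ring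
  have et : 2 * -A * (z'.2.2 - z.2.2) + 2 * 0 * z'.2.2 = qt := by rw [hqt]; ring
  rw [ex, ey, et] at hsup
  have aqy : |qy| = 2 * A * a := by
    rw [hqy, abs_mul, abs_of_nonneg (by positivity : 0 ≤ 2 * A)]
  have aqt : |qt| = 2 * A * b := by
    rw [hqt, abs_mul, abs_of_nonneg (by positivity : 0 ≤ 2 * A)]
  set px := qx + (2 * κ) • z.1 with hpx
  set py := qy + 2 * κ * z.2.1 with hpy
  have apy : |py| ≤ 2 * A * a + s := by
    rw [← aqy]; exact (abs_add_le _ _).trans (by linarith)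
  have hAa : 2 * A * a ≤ 2 * A * s := by gcongr
  have hAb : 2 * A * b ≤ 2 * A * s := by gcongr
  have hlow : C₁ * ‖px‖ - C₂ - C₅ * |py| ≤ G z.1 z.2.1 z.2.2 px py := by
    have i1 := lip_py h1 h3 z.1 z.2.1 z.2.2 px 0 py
    rw [zero_add] at i1
    have i2 := hco z.1 z.2.1 z.2.2 px
    linarith [(abs_le.1 i1).1]
  have hpyK : |py| ≤ 2 * A * s + 1 := by linarith
  have hpxK' : C₁ * ‖px‖ ≤ |lam₁| + C₂ + C₅ * (2 * A * s + 1) + 2 * A * s + 1 := by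
    have i1 : C₅ * |py| ≤ C₅ * (2 * A * s + 1) := by gcongr
    have i2 := neg_abs_le qt
    have i3 := neg_abs_le (2 * κ * z.2.2)
    have i4 := le_abs_self lam₁
    linarith
  have hpxK0 : ‖px‖ ≤ (|lam₁| + C₂ + C₅ * (2 * A * s + 1) + 2 * A * s + 1) / C₁ := by
    rw [le_div_iff₀ hC₁]; linarith
  have hAs : 0 ≤ 2 * A * s := by positivity
  have hpxK : ‖px‖ ≤ K := by rw [hK]; linarith
  have hpyK2 : |py| ≤ K := by
    rw [hK]
    have := (norm_nonneg px).trans hpxK0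
    linarith
  have h01 := Hρ z.1 z'.1 z.2.1 z.2.2 px qx py qy hxx
    (by rw [hpx, add_sub_cancel_left]; linarith)
    (by rw [hpy, add_sub_cancel_left]; linarith) hpxK hpyK2
  have h12 := lip_y h1 h3 z'.1 z.2.1 z.2.2 qx qy (z'.2.1 - z.2.1)
  rw [add_sub_cancel, abs_sub_comm z'.2.1, ← ha] at h12
  have h23 := lip_t h1 h3 z'.1 z'.2.1 z.2.2 qx qy (z'.2.2 - z.2.2) (by
    rw [abs_sub_comm, ← hb]
    exact le_trans (by gcongr) hs4)
  rw [add_sub_cancel, abs_sub_comm z'.2.2, ← hb] at h23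
  refine final_num hC₂.le hC₃ hC₄ hC₅ hs0 hs1 ha0 hb0 has hbs hA1 haa hbb aqt aqy
    (kt := 2 * κ * z.2.2) (by linarith) apy (G0 := G z.1 z.2.1 z.2.2 px py)
    (by linarith) ?_ h01.le h12 h23 (by linarith)
  have : 0 ≤ C₁ * ‖px‖ := by positivity
  linarith

end Helpers

/-- Under (H1)–(H3), if `w_t + G = λ₁` admits a bounded usc viscosity
subsolution and `w_t + G = λ₂` admits a bounded lsc viscosity supersolution, then
λ₁ ≥ λ₂. -/
theorem statement13 {n : ℕ} (hn : 0 < n) (G : Ham n) (C₁ C₂ l C₃ C₄ C₅ : ℝ)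
    (h1 : HypH1 G) (h2 : HypH2 G C₁ C₂) (h3 : HypH3 G l C₃ C₄ C₅)
    (lam₁ lam₂ : ℝ)
    (hsub : ∃ u : Dom n → ℝ, Bdd u ∧ ViscSub G 0 lam₁ u)
    (hsuper : ∃ v : Dom n → ℝ, Bdd v ∧ ViscSuper G 0 lam₂ v) :
    lam₂ ≤ lam₁ := by
  obtain ⟨u, ⟨M₁, hM₁⟩, hu⟩ := hsub
  obtain ⟨v, ⟨M₂, hM₂⟩, hv⟩ := hsuper
  have key := main_aux G C₁ C₂ l C₃ C₄ C₅ h1 h2 h3 lam₁ lam₂ u v (max M₁ M₂)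
    (fun z => (hM₁ z).trans (le_max_left _ _)) (fun z => (hM₂ z).trans (le_max_right _ _)) hu hv
  have hC₂ := h2.2.1
  have hC₃ := h3.1
  have hC₄ := h3.2.1
  have hC₅ := h3.2.2.1
  set D := 2 + C₃ * (2 + |l|) + 2 * C₄ * (7 + |lam₁| + C₂ + 3 * C₅ + C₃ * (2 + |l|)) with hD
  have hD0 : 0 < D := by positivity
  by_contra hcon
  push Not at hcon
  have hd : 0 < lam₂ - lam₁ := by linarith
  set s := min 1 (min (1 / (2 * (C₄ + 1))) ((lam₂ - lam₁) / (2 * D))) with hs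
  have hs0 : 0 < s := by positivity
  have hs1 : s ≤ 1 := min_le_left _ _
  have hs2 : s ≤ 1 / (2 * (C₄ + 1)) := (min_le_right _ _).trans (min_le_left _ _)
  have hs3 : s ≤ (lam₂ - lam₁) / (2 * D) := (min_le_right _ _).trans (min_le_right _ _)
  rw [le_div_iff₀ (by positivity)] at hs2 hs3
  have := key s hs0 hs1 (by nlinarith)
  nlinarith
end
end

section
/- Assume F satisfies (H1), (H2') and (H3) with l = 0, and let F̄ : ℝⁿ×ℝ → ℝ be the homogenized Hamiltonian, i.e. F̄(p_x,p_y) is the unique constant λ for which the cell problem v_t + F(x,y,t, p_x + D_x v, p_y + D_y v) = λ admits bounded space-time periodic sub- and supersolutions. Then F̄ is a continuous function on ℝⁿ×ℝ. -/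
open MeasureTheory Topology Filter
open scoped RealInnerProductSpace

noncomputable section

lemma abs_sub_le_of_ae {f h : ℝ → ℝ} (hf : LocallyLipschitz f) (hh : Continuous h)
    (hd : ∀ᵐ s : ℝ, |deriv f s| ≤ h s) (a b : ℝ) (hab : a ≤ b) :
    |f b - f a| ≤ ∫ s in a..b, h s := by
  obtain ⟨K, hK⟩ := (hf.locallyLipschitzOn (s := Set.uIcc a b)).exists_lipschitzOnWith_of_compact
    isCompact_uIcc
  have hac := hK.absolutelyContinuousOnInterval
  rw [← hac.integral_deriv_eq_sub]
  have := intervalIntegral.norm_integral_le_of_norm_le (μ := volume) hab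
    (f := deriv f) (g := h) (hd.mono fun s hs _ => hs) (hh.intervalIntegrable _ _)
  exact this

lemma forall_of_ae_closed {X : Type*} [TopologicalSpace X] [MeasurableSpace X]
    (μ : Measure X) [μ.IsOpenPosMeasure] {p : X → Prop} (hp : ∀ᵐ x ∂μ, p x)
    (hc : IsClosed {x | p x}) (x : X) : p x := by
  have := (Measure.dense_of_ae hp).closure_eq
  rw [hc.closure_eq] at this
  have h : x ∈ {x | p x} := by rw [this]; trivial
  exact h

lemma bound_y {n : ℕ} {F : Ham n} {C₃ C₄ C₅ : ℝ} (h1 : HypH1 F) (h3 : HypH3 F 0 C₃ C₄ C₅)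
    (x : Euc n) (t : ℝ) (px : Euc n) (py a b : ℝ) (hab : a ≤ b) :
    |F x b t px py - F x a t px py| ≤ C₃ * |py| * (b - a) := by
  obtain ⟨hF, -⟩ := h1
  obtain ⟨-, -, -, hL, hae⟩ := h3
  have key : ∀ᵐ x : Euc n, ∀ r : ℝ × Euc n × ℝ,
      |F x b r.1 r.2.1 r.2.2 - F x a r.1 r.2.1 r.2.2| ≤ C₃ * |r.2.2| * (b - a) := by
    have h := Measure.ae_ae_of_ae_prod (hae.mono fun ξ h => h.1)
    filter_upwards [h] with x hx
    have hsw := (Measure.measurePreserving_swap (μ := (volume : Measure (ℝ × Euc n × ℝ)))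
      (ν := (volume : Measure ℝ))).quasiMeasurePreserving.ae hx
    have h2 := Measure.ae_ae_of_ae_prod hsw
    refine forall_of_ae_closed volume (p := fun r : ℝ × Euc n × ℝ =>
      |F x b r.1 r.2.1 r.2.2 - F x a r.1 r.2.1 r.2.2| ≤ C₃ * |r.2.2| * (b - a)) ?_ ?_
    · filter_upwards [h2] with r hr
      have hl : LocallyLipschitz (fun y => F x y r.1 r.2.1 r.2.2) :=
        (hL x r.2.1).comp (LocallyLipschitz.prodMk_right (r.1, r.2.2))
      have := abs_sub_le_of_ae hl (h := fun _ => C₃ * |r.2.2|) continuous_const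
        (by simpa using hr) a b hab
      simpa [mul_comm, mul_left_comm, mul_assoc] using this
    · refine isClosed_le (Continuous.abs (Continuous.sub ?_ ?_)) (by fun_prop)
      · exact hF.comp (f := fun r : ℝ × Euc n × ℝ => (x, b, r.1, r.2.1, r.2.2)) (by fun_prop)
      · exact hF.comp (f := fun r : ℝ × Euc n × ℝ => (x, a, r.1, r.2.1, r.2.2)) (by fun_prop)
  refine forall_of_ae_closed volume (p := fun x : Euc n =>
      |F x b t px py - F x a t px py| ≤ C₃ * |py| * (b - a)) ?_ ?_ x
  · filter_upwards [key] with x hx using hx (t, px, py)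
  · refine isClosed_le (Continuous.abs (Continuous.sub ?_ ?_)) (by fun_prop)
    · exact hF.comp (f := fun x : Euc n => (x, b, t, px, py)) (by fun_prop)
    · exact hF.comp (f := fun x : Euc n => (x, a, t, px, py)) (by fun_prop)

lemma bound_t {n : ℕ} {F : Ham n} {C₃ C₄ C₅ : ℝ} (h1 : HypH1 F) (h3 : HypH3 F 0 C₃ C₄ C₅)
    (x : Euc n) (y : ℝ) (px : Euc n) (py a b : ℝ) (hab : a ≤ b) :
    |F x y b px py - F x y a px py| ≤ ∫ s in a..b, C₄ * (1 + |py| + |F x y s px py|) := by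
  obtain ⟨hF, -⟩ := h1
  obtain ⟨-, -, -, hL, hae⟩ := h3
  have key : ∀ᵐ x : Euc n, ∀ᵐ y : ℝ, ∀ r : Euc n × ℝ,
      |F x y b r.1 r.2 - F x y a r.1 r.2| ≤
        ∫ s in a..b, C₄ * (1 + |r.2| + |F x y s r.1 r.2|) := by
    have h := Measure.ae_ae_of_ae_prod (hae.mono fun ξ h => h.2.1)
    filter_upwards [h] with x hx
    filter_upwards [Measure.ae_ae_of_ae_prod hx] with y hy
    have hsw := (Measure.measurePreserving_swap (μ := (volume : Measure (Euc n × ℝ)))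
      (ν := (volume : Measure ℝ))).quasiMeasurePreserving.ae hy
    have h2 := Measure.ae_ae_of_ae_prod hsw
    refine forall_of_ae_closed volume (p := fun r : Euc n × ℝ =>
      |F x y b r.1 r.2 - F x y a r.1 r.2| ≤
        ∫ s in a..b, C₄ * (1 + |r.2| + |F x y s r.1 r.2|)) ?_ ?_
    · filter_upwards [h2] with r hr
      have hl : LocallyLipschitz (fun t => F x y t r.1 r.2) :=
        (hL x r.1).comp ((LocallyLipschitz.prodMk_left y).comp
          (LocallyLipschitz.prodMk_right r.2))
      have hc : Continuous (fun t => F x y t r.1 r.2) := hl.continuous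
      exact abs_sub_le_of_ae hl (h := fun s => C₄ * (1 + |r.2| + |F x y s r.1 r.2|))
        (by fun_prop) hr a b hab
    · refine isClosed_le (Continuous.abs (Continuous.sub ?_ ?_)) ?_
      · exact hF.comp (f := fun r : Euc n × ℝ => (x, y, b, r.1, r.2)) (by fun_prop)
      · exact hF.comp (f := fun r : Euc n × ℝ => (x, y, a, r.1, r.2)) (by fun_prop)
      · refine intervalIntegral.continuous_parametric_intervalIntegral_of_continuous' ?_ a b
        have : Continuous (fun q : (Euc n × ℝ) × ℝ => F x y q.2 q.1.1 q.1.2) :=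
          hF.comp (f := fun q : (Euc n × ℝ) × ℝ => (x, y, q.2, q.1.1, q.1.2)) (by fun_prop)
        unfold Function.uncurry
        fun_prop
  have key2 : ∀ᵐ x : Euc n, ∀ y : ℝ, 
      |F x y b px py - F x y a px py| ≤ ∫ s in a..b, C₄ * (1 + |py| + |F x y s px py|) := by
    filter_upwards [key] with x hx
    refine forall_of_ae_closed volume (p := fun y : ℝ =>
      |F x y b px py - F x y a px py| ≤ ∫ s in a..b, C₄ * (1 + |py| + |F x y s px py|)) ?_ ?_
    · filter_upwards [hx] with y hy using hy (px, py)
    · refine isClosed_le (Continuous.abs (Continuous.sub ?_ ?_)) ?_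
      · exact hF.comp (f := fun y : ℝ => (x, y, b, px, py)) (by fun_prop)
      · exact hF.comp (f := fun y : ℝ => (x, y, a, px, py)) (by fun_prop)
      · refine intervalIntegral.continuous_parametric_intervalIntegral_of_continuous' ?_ a b
        have : Continuous (fun q : ℝ × ℝ => F x q.1 q.2 px py) :=
          hF.comp (f := fun q : ℝ × ℝ => (x, q.1, q.2, px, py)) (by fun_prop)
        unfold Function.uncurry
        fun_prop
  refine forall_of_ae_closed volume (p := fun x : Euc n =>
      |F x y b px py - F x y a px py| ≤ ∫ s in a..b, C₄ * (1 + |py| + |F x y s px py|)) ?_ ?_ x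
  · filter_upwards [key2] with x hx using hx y
  · refine isClosed_le (Continuous.abs (Continuous.sub ?_ ?_)) ?_
    · exact hF.comp (f := fun x : Euc n => (x, y, b, px, py)) (by fun_prop)
    · exact hF.comp (f := fun x : Euc n => (x, y, a, px, py)) (by fun_prop)
    · refine intervalIntegral.continuous_parametric_intervalIntegral_of_continuous' ?_ a b
      have : Continuous (fun q : Euc n × ℝ => F q.1 y q.2 px py) :=
        hF.comp (f := fun q : Euc n × ℝ => (q.1, y, q.2, px, py)) (by fun_prop)
      unfold Function.uncurry
      fun_prop

lemma bound_py {n : ℕ} {F : Ham n} {C₃ C₄ C₅ : ℝ} (h1 : HypH1 F) (h3 : HypH3 F 0 C₃ C₄ C₅)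
    (x : Euc n) (y t : ℝ) (px : Euc n) (a b : ℝ) (hab : a ≤ b) :
    |F x y t px b - F x y t px a| ≤ C₅ * (b - a) := by
  obtain ⟨hF, -⟩ := h1
  obtain ⟨-, -, -, hL, hae⟩ := h3
  have h := Measure.ae_ae_of_ae_prod (hae.mono fun ξ h => h.2.2)
  refine forall_of_ae_closed volume (p := fun x : Euc n => ∀ y t px,
      |F x y t px b - F x y t px a| ≤ C₅ * (b - a)) ?_ ?_ x y t px
  · filter_upwards [h] with x hx
    refine forall_of_ae_closed volume (p := fun y : ℝ => ∀ t px,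
      |F x y t px b - F x y t px a| ≤ C₅ * (b - a)) ?_ ?_
    · filter_upwards [Measure.ae_ae_of_ae_prod hx] with y hy
      refine forall_of_ae_closed volume (p := fun t : ℝ => ∀ px,
        |F x y t px b - F x y t px a| ≤ C₅ * (b - a)) ?_ ?_
      · filter_upwards [Measure.ae_ae_of_ae_prod hy] with t ht
        refine forall_of_ae_closed volume (p := fun px : Euc n =>
          |F x y t px b - F x y t px a| ≤ C₅ * (b - a)) ?_ ?_
        · filter_upwards [Measure.ae_ae_of_ae_prod ht] with px hpx
          have hl : LocallyLipschitz (fun py => F x y t px py) :=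
            (hL x px).comp ((LocallyLipschitz.prodMk_left y).comp
              (LocallyLipschitz.prodMk_left t))
          have := abs_sub_le_of_ae hl (h := fun _ => C₅) continuous_const hpx a b hab
          simpa [mul_comm] using this
        · refine isClosed_le (Continuous.abs (Continuous.sub ?_ ?_)) (by fun_prop)
          · exact hF.comp (f := fun px : Euc n => (x, y, t, px, b)) (by fun_prop)
          · exact hF.comp (f := fun px : Euc n => (x, y, t, px, a)) (by fun_prop)
      · simp only [Set.ofPred_forall]
        refine isClosed_iInter fun px => ?_
        refine isClosed_le (Continuous.abs (Continuous.sub ?_ ?_)) (by fun_prop)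
        · exact hF.comp (f := fun t : ℝ => (x, y, t, px, b)) (by fun_prop)
        · exact hF.comp (f := fun t : ℝ => (x, y, t, px, a)) (by fun_prop)
    · simp only [Set.ofPred_forall]
      refine isClosed_iInter fun t => isClosed_iInter fun px => ?_
      refine isClosed_le (Continuous.abs (Continuous.sub ?_ ?_)) (by fun_prop)
      · exact hF.comp (f := fun y : ℝ => (x, y, t, px, b)) (by fun_prop)
      · exact hF.comp (f := fun y : ℝ => (x, y, t, px, a)) (by fun_prop)
  · simp only [Set.ofPred_forall]
    refine isClosed_iInter fun y => isClosed_iInter fun t => isClosed_iInter fun px => ?_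
    refine isClosed_le (Continuous.abs (Continuous.sub ?_ ?_)) (by fun_prop)
    · exact hF.comp (f := fun x : Euc n => (x, y, t, px, b)) (by fun_prop)
    · exact hF.comp (f := fun x : Euc n => (x, y, t, px, a)) (by fun_prop)

lemma bound_y' {n : ℕ} {F : Ham n} {C₃ C₄ C₅ : ℝ} (h1 : HypH1 F) (h3 : HypH3 F 0 C₃ C₄ C₅)
    (x : Euc n) (t : ℝ) (px : Euc n) (py a b : ℝ) :
    |F x b t px py - F x a t px py| ≤ C₃ * |py| * |b - a| := by
  rcases le_total a b with h | h
  · rw [abs_of_nonneg (sub_nonneg.2 h)]; exact bound_y h1 h3 x t px py a b h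
  · rw [abs_sub_comm b a, abs_of_nonneg (sub_nonneg.2 h), abs_sub_comm]
    exact bound_y h1 h3 x t px py b a h

lemma lower_F {n : ℕ} {F : Ham n} {C₃ C₄ C₅ : ℝ} (h1 : HypH1 F) (h3 : HypH3 F 0 C₃ C₄ C₅)
    (h2 : HypH2' F) : ∃ C : ℝ, 0 ≤ C ∧ ∀ x y t px py, -C - C₅ * |py| ≤ F x y t px py := by
  obtain ⟨C₁, C₂, hC1, hC2, h⟩ := h2 1 one_pos
  refine ⟨C₂, hC2.le, fun x y t px py => ?_⟩
  have h0 := h x y t px 0 (by simp)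
  have hp : 0 ≤ C₁ * ‖px‖ := by positivity
  have : |F x y t px py - F x y t px 0| ≤ C₅ * |py| := by
    rcases le_total 0 py with hh | hh
    · have := bound_py h1 h3 x y t px 0 py hh
      rw [abs_of_nonneg hh]; simpa using this
    · have := bound_py h1 h3 x y t px py 0 hh
      rw [abs_of_nonpos hh, abs_sub_comm]; simpa using this
  have := (abs_le.1 this).1
  linarith

/-- A Gronwall-type bound in the time variable. -/
lemma bound_t' {n : ℕ} {F : Ham n} {C₃ C₄ C₅ : ℝ} (h1 : HypH1 F) (h3 : HypH3 F 0 C₃ C₄ C₅)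
    (x : Euc n) (y : ℝ) (px : Euc n) (py a b : ℝ) (hs : C₄ * |b - a| ≤ 1 / 2) :
    |F x y b px py - F x y a px py| ≤ 2 * C₄ * |b - a| * (1 + |py| + |F x y a px py|) := by
  have hC4 : 0 ≤ C₄ := h3.2.1
  have hc : Continuous (fun t => F x y t px py) :=
    h1.1.comp (f := fun t : ℝ => (x, y, t, px, py)) (by fun_prop)
  have hc2 : Continuous (fun t => |F x y t px py - F x y a px py|) := by fun_prop
  obtain ⟨c, hcm, hmax⟩ := (isCompact_uIcc (a := a) (b := b)).exists_isMaxOn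
    ⟨a, Set.left_mem_uIcc⟩ hc2.continuousOn
  set m := |F x y c px py - F x y a px py| with hm
  have hbd : ∀ s ∈ Set.uIcc a b, |F x y s px py| ≤ |F x y a px py| + m := by
    intro s hs
    have h1 := hmax hs
    simp only [Set.mem_ofPred_eq] at h1
    have := abs_sub_abs_le_abs_sub (F x y s px py) (F x y a px py)
    linarith
  have hca : |c - a| ≤ |b - a| := Set.abs_sub_left_of_mem_uIcc hcm
  have hmle : m ≤ C₄ * (1 + |py| + (|F x y a px py| + m)) * |c - a| := by
    have gen : ∀ a' b' : ℝ, a' ≤ b' → Set.Icc a' b' ⊆ Set.uIcc a b → 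
        |F x y b' px py - F x y a' px py| ≤ 
          C₄ * (1 + |py| + (|F x y a px py| + m)) * (b' - a') := by
      intro a' b' h hsub
      refine (bound_t h1 h3 x y px py a' b' h).trans ?_
      have := intervalIntegral.integral_mono_on (μ := volume) h
        (f := fun s => C₄ * (1 + |py| + |F x y s px py|))
        (g := fun _ => C₄ * (1 + |py| + (|F x y a px py| + m)))
        ((by fun_prop : Continuous _).intervalIntegrable _ _)
        ((by fun_prop : Continuous _).intervalIntegrable _ _)
        (fun s hs => by
          have := hbd s (hsub hs)
          gcongr)
      refine this.trans (le_of_eq ?_)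
      rw [intervalIntegral.integral_const, smul_eq_mul, mul_comm]
    rcases le_total a c with h | h
    · rw [abs_of_nonneg (sub_nonneg.2 h)]
      refine gen a c h ?_
      rw [← Set.uIcc_of_le h]
      exact Set.uIcc_subset_uIcc_left hcm
    · rw [abs_sub_comm c a, abs_of_nonneg (sub_nonneg.2 h)]
      refine (le_of_eq (hm.trans (abs_sub_comm _ _))).trans (gen c a h ?_)
      rw [← Set.uIcc_of_ge h]
      exact Set.uIcc_subset_uIcc_left hcm
  have hb := hmax (Set.right_mem_uIcc (a := a) (b := b))
  simp only [Set.mem_ofPred_eq] at hb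
  have hm0 : 0 ≤ m := abs_nonneg _
  have hA : 0 ≤ 1 + |py| + |F x y a px py| := by positivity
  have h4 : m ≤ (C₄ * |b - a|) * (1 + |py| + |F x y a px py|) + (C₄ * |b - a|) * m := by
    have : C₄ * (1 + |py| + (|F x y a px py| + m)) * |c - a| ≤
        C₄ * (1 + |py| + (|F x y a px py| + m)) * |b - a| := by gcongr
    linarith
  have h5 : (C₄ * |b - a|) * m ≤ 1 / 2 * m := by gcongr
  linarith
/-- The penalization used in the doubling of variables. -/
def pen {n : ℕ} (δ ε N : ℝ) (z : Dom n) : ℝ :=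
  δ * (Real.log (ε ^ 2 + z.2.1 ^ 2 + z.2.2 ^ 2) - Real.log (ε ^ 2)) + N * ‖z.1‖ ^ 2

/-- The derivative of the penalization. -/
def penD {n : ℕ} (δ ε N : ℝ) (z : Dom n) : Dom n →L[ℝ] ℝ :=
  (2 * δ / (ε ^ 2 + z.2.1 ^ 2 + z.2.2 ^ 2)) •
    (z.2.1 • (ContinuousLinearMap.fst ℝ ℝ ℝ).comp (ContinuousLinearMap.snd ℝ (Euc n) (ℝ × ℝ)) +
     z.2.2 • (ContinuousLinearMap.snd ℝ ℝ ℝ).comp (ContinuousLinearMap.snd ℝ (Euc n) (ℝ × ℝ))) +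
  (2 * N) • (innerSL ℝ z.1).comp (ContinuousLinearMap.fst ℝ (Euc n) (ℝ × ℝ))

lemma pen_contDiff {n : ℕ} {δ ε N : ℝ} (hε : 0 < ε) : ContDiff ℝ 1 (pen (n := n) δ ε N) := by
  unfold pen
  have h : ContDiff ℝ 1 (fun z : Dom n => Real.log (ε ^ 2 + z.2.1 ^ 2 + z.2.2 ^ 2)) :=
    ContDiff.log (by fun_prop) (fun z => by positivity)
  have h' : ContDiff ℝ 1 (fun z : Dom n => ‖z.1‖ ^ 2) := contDiff_fst.norm_sq ℝ
  fun_prop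

lemma pen_hasFDerivAt {n : ℕ} {δ ε N : ℝ} (hε : 0 < ε) (z : Dom n) :
    HasFDerivAt (pen (n := n) δ ε N) (penD δ ε N z) z := by
  have hy : HasFDerivAt (fun w : Dom n => w.2.1) ((ContinuousLinearMap.fst ℝ ℝ ℝ).comp
    (ContinuousLinearMap.snd ℝ (Euc n) (ℝ × ℝ))) z :=
    ((ContinuousLinearMap.fst ℝ ℝ ℝ).comp
      (ContinuousLinearMap.snd ℝ (Euc n) (ℝ × ℝ))).hasFDerivAt
  have ht : HasFDerivAt (fun w : Dom n => w.2.2) ((ContinuousLinearMap.snd ℝ ℝ ℝ).comp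
    (ContinuousLinearMap.snd ℝ (Euc n) (ℝ × ℝ))) z :=
    ((ContinuousLinearMap.snd ℝ ℝ ℝ).comp
      (ContinuousLinearMap.snd ℝ (Euc n) (ℝ × ℝ))).hasFDerivAt
  have hx : HasFDerivAt (fun w : Dom n => w.1) (ContinuousLinearMap.fst ℝ (Euc n) (ℝ × ℝ)) z :=
    hasFDerivAt_fst
  have hD : (ε ^ 2 + z.2.1 ^ 2 + z.2.2 ^ 2) ≠ 0 := by positivity
  have h1 := ((((hy.pow 2).const_add (ε ^ 2)).add (ht.pow 2)).log hD).sub_const (Real.log (ε ^ 2))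
  have h2 := (h1.const_mul δ).add (hx.norm_sq.const_mul N)
  refine h2.congr_fderiv ?_
  ext v
  · simp [penD]; ring
  · simp [penD]; field_simp
  · simp [penD]; field_simp

lemma pd_of_penD {n : ℕ} {δ ε N : ℝ} {φ : Dom n → ℝ} {z d : Dom n}
    (h : HasFDerivAt φ (penD δ ε N d) z) :
    pdT φ z = 2 * δ / (ε ^ 2 + d.2.1 ^ 2 + d.2.2 ^ 2) * d.2.2 ∧
    pdY φ z = 2 * δ / (ε ^ 2 + d.2.1 ^ 2 + d.2.2 ^ 2) * d.2.1 ∧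
    pdX φ z = (2 * N) • d.1 := by
  refine ⟨?_, ?_, ?_⟩
  · simp [pdT, h.fderiv, penD]
  · simp [pdY, h.fderiv, penD]
  · ext i
    simp [pdX, h.fderiv, penD, EuclideanSpace.inner_single_right]

lemma pen_zero {n : ℕ} (δ ε N : ℝ) : pen (n := n) δ ε N 0 = 0 := by simp [pen]

lemma pen_le {n : ℕ} {δ ε N K : ℝ} (hδ : 0 < δ) (hε : 0 < ε) (hN : 0 < N) {d : Dom n}
    (h : pen δ ε N d ≤ K) :
    d.2.1 ^ 2 + d.2.2 ^ 2 ≤ ε ^ 2 * Real.exp (K / δ) ∧ ‖d.1‖ ^ 2 ≤ K / N := by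
  unfold pen at h
  have h0 : 0 ≤ N * ‖d.1‖ ^ 2 := by positivity
  have hle : Real.log (ε ^ 2) ≤ Real.log (ε ^ 2 + d.2.1 ^ 2 + d.2.2 ^ 2) :=
    Real.log_le_log (by positivity) (by nlinarith [sq_nonneg d.2.1, sq_nonneg d.2.2])
  have h1 : 0 ≤ δ * (Real.log (ε ^ 2 + d.2.1 ^ 2 + d.2.2 ^ 2) - Real.log (ε ^ 2)) :=
    mul_nonneg hδ.le (by linarith)
  constructor
  · have h2 : Real.log (ε ^ 2 + d.2.1 ^ 2 + d.2.2 ^ 2) - Real.log (ε ^ 2) ≤ K / δ := by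
      rw [le_div_iff₀ hδ]; linarith
    have h3 : ε ^ 2 + d.2.1 ^ 2 + d.2.2 ^ 2 ≤ ε ^ 2 * Real.exp (K / δ) := by
      rw [← Real.log_le_log_iff (by positivity) (by positivity),
        Real.log_mul (by positivity) (by positivity), Real.log_exp]
      linarith
    nlinarith [sq_nonneg ε]
  · rw [le_div_iff₀ hN]; linarith

/-- lattice vectors -/
def lat {n : ℕ} (k : Fin n → ℤ) (l m : ℤ) : Dom n := (intVec k, (l : ℝ), (m : ℝ))

lemma STPeriodic.shift {n : ℕ} {u : Dom n → ℝ} (hu : STPeriodic u) (k : Fin n → ℤ) (l m : ℤ)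
    (z : Dom n) : u (z + lat k l m) = u z := by
  obtain ⟨x, y, t⟩ := z
  have h1 : Function.Periodic (fun y => u (x, y, t)) 1 := fun y => hu.2.1 x y t
  have h2 : Function.Periodic (fun t => u (x, y + l, t)) 1 := fun t => hu.2.2 x _ t
  have e1 := h1.int_mul l y
  have e2 := h2.int_mul m t
  simp only [mul_one] at e1 e2
  change u (x + intVec k, y + l, t + m) = _
  rw [hu.1, e2, e1]

lemma exists_lat {n : ℕ} (z : Dom n) : ∃ k l m, ‖z + lat k l m‖ ≤ n + 1 := by
  obtain ⟨x, y, t⟩ := z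
  refine ⟨fun i => -⌊x i⌋, -⌊y⌋, -⌊t⌋, ?_⟩
  have hfr : ∀ s : ℝ, |s + ((-⌊s⌋ : ℤ) : ℝ)| ≤ 1 := by
    intro s
    push_cast
    rw [abs_le]
    constructor <;> linarith [Int.floor_le s, Int.lt_floor_add_one s]
  have hn : (0 : ℝ) ≤ n := Nat.cast_nonneg n
  change ‖(x + intVec _, y + _, t + _)‖ ≤ _
  refine norm_prod_le_iff.2 ⟨?_, norm_prod_le_iff.2 ⟨?_, ?_⟩⟩
  · refine le_of_sq_le_sq ?_ (by positivity)
    rw [EuclideanSpace.norm_sq_eq]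
    have : ∀ i : Fin n, ‖(x + intVec (fun i => -⌊x i⌋)) i‖ ^ 2 ≤ 1 := by
      intro i
      have := hfr (x i)
      have h2 : ‖(x + intVec (fun i => -⌊x i⌋)) i‖ ≤ 1 := by
        simpa [intVec] using this
      exact pow_le_one₀ (norm_nonneg _) h2
    calc _ ≤ ∑ i : Fin n, (1 : ℝ) := Finset.sum_le_sum fun i _ => this i
      _ = n := by simp
      _ ≤ _ := by nlinarith
  · have := hfr y
    change |_| ≤ _
    exact this.trans (by linarith)
  · have := hfr t
    change |_| ≤ _
    exact this.trans (by linarith)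

lemma exists_max_s15 {n : ℕ} {δ ε N : ℝ} (hδ : 0 < δ) (hε : 0 < ε) (hN : 0 < N) {u v : Dom n → ℝ}
    (hub : Bdd u) (hvb : Bdd v) (hup : STPeriodic u) (hvp : STPeriodic v)
    (hu : UpperSemicontinuous u) (hv : LowerSemicontinuous v) :
    ∃ z z' : Dom n, ‖z‖ ≤ n + 1 ∧
      ∀ w w', u w - v w' - pen δ ε N (w - w') ≤ u z - v z' - pen δ ε N (z - z') := by
  obtain ⟨M₁, hM₁⟩ := hub
  obtain ⟨M₂, hM₂⟩ := hvb
  set M := M₁ + M₂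
  have hn : (0 : ℝ) ≤ n := Nat.cast_nonneg n
  obtain ⟨B, hB0, hB⟩ : ∃ B : ℝ, 0 ≤ B ∧ ∀ d : Dom n, pen δ ε N d ≤ 2 * M → ‖d‖ ≤ B := by
    refine ⟨max (Real.sqrt (2 * M / N)) (Real.sqrt (ε ^ 2 * Real.exp (2 * M / δ))),
      le_max_of_le_left (Real.sqrt_nonneg _), fun d hd => ?_⟩
    obtain ⟨h1, h2⟩ := pen_le hδ hε hN hd
    refine norm_prod_le_iff.2 ⟨le_max_of_le_left (Real.le_sqrt_of_sq_le h2),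
      norm_prod_le_iff.2 ⟨le_max_of_le_right (Real.le_sqrt_of_sq_le ?_),
        le_max_of_le_right (Real.le_sqrt_of_sq_le ?_)⟩⟩
    · rw [Real.norm_eq_abs, sq_abs]; nlinarith [sq_nonneg d.2.2]
    · rw [Real.norm_eq_abs, sq_abs]; nlinarith [sq_nonneg d.2.1]
  set Φ : Dom n × Dom n → ℝ := fun q => u q.1 - v q.2 - pen δ ε N (q.1 - q.2) with hΦ
  have husc : UpperSemicontinuous Φ := by
    have a1 : UpperSemicontinuous (fun q : Dom n × Dom n => u q.1) := hu.comp continuous_fst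
    have a2 : UpperSemicontinuous (fun q : Dom n × Dom n => - v q.2) :=
      (hv.comp continuous_snd).neg
    have a3 : UpperSemicontinuous (fun q : Dom n × Dom n => - pen δ ε N (q.1 - q.2)) := by
      have := (pen_contDiff (n := n) (δ := δ) (N := N) hε).continuous
      exact Continuous.upperSemicontinuous (by fun_prop)
    have := (a1.add a2).add a3
    simpa only [hΦ, sub_eq_add_neg] using this
  obtain ⟨q, hq, hmax⟩ := UpperSemicontinuousOn.exists_isMaxOn
    (s := Metric.closedBall (0 : Dom n) (n + 1) ×ˢ Metric.closedBall (0 : Dom n) (n + 1 + B))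
    ⟨(0, 0), by simp; constructor <;> positivity⟩
    ((isCompact_closedBall _ _).prod (isCompact_closedBall _ _)) (husc.upperSemicontinuousOn _)
  have hq1 : ‖q.1‖ ≤ n + 1 := by simpa using hq.1
  refine ⟨q.1, q.2, hq1, fun w w' => ?_⟩
  have h00 : -M ≤ Φ q := by
    have h : Φ (0, 0) ≤ Φ q := hmax (by simp; constructor <;> positivity)
    refine le_trans ?_ h
    simp only [hΦ, sub_zero, pen_zero]
    have := abs_le.1 (hM₁ 0)
    have := abs_le.1 (hM₂ 0)
    simp only [M]; linarith
  change _ ≤ Φ q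
  by_cases hp : pen δ ε N (w - w') ≤ 2 * M
  · obtain ⟨k, l, m, hk⟩ := exists_lat w
    have hd := hB _ hp
    have : Φ (w + lat k l m, w' + lat k l m) ≤ Φ q := by
      apply hmax
      refine ⟨by simpa using hk, ?_⟩
      simp only [mem_closedBall_zero_iff]
      have e : w' + lat k l m = (w + lat k l m) - (w - w') := by abel
      rw [e]
      exact (norm_sub_le _ _).trans (add_le_add hk hd)
    simpa only [hΦ, hup.shift, hvp.shift, add_sub_add_right_eq_sub] using this
  · push Not at hp
    have := abs_le.1 (hM₁ w)
    have := abs_le.1 (hM₂ w')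
    simp only [M] at *; linarith
lemma pen_real {δ ε : ℝ} (hδ : 0 < δ) (hε : 0 < ε) (b c : ℝ) :
    |2 * δ / (ε ^ 2 + b ^ 2 + c ^ 2) * b| ≤ δ / ε ∧
    |2 * δ / (ε ^ 2 + b ^ 2 + c ^ 2) * b| * |b| ≤ 2 * δ ∧
    |2 * δ / (ε ^ 2 + b ^ 2 + c ^ 2) * b| * |c| ≤ δ := by
  have hD : 0 < ε ^ 2 + b ^ 2 + c ^ 2 := by positivity
  have e : |2 * δ / (ε ^ 2 + b ^ 2 + c ^ 2) * b| = 2 * δ * |b| / (ε ^ 2 + b ^ 2 + c ^ 2) := by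
    rw [abs_mul, abs_of_pos (by positivity)]; ring
  rw [e]
  have hb := sq_abs b
  have hc := sq_abs c
  refine ⟨?_, ?_, ?_⟩
  · rw [div_le_div_iff₀ hD hε]
    nlinarith [sq_nonneg (|b| - ε), sq_nonneg c]
  · rw [div_mul_eq_mul_div, div_le_iff₀ hD]
    nlinarith [sq_nonneg c, sq_nonneg ε]
  · rw [div_mul_eq_mul_div, div_le_iff₀ hD]
    nlinarith [sq_nonneg (|b| - |c|), sq_nonneg ε]

set_option maxHeartbeats 2000000 in
lemma comparison_s15 {n : ℕ} {F : Ham n} {C₃ C₄ C₅ : ℝ}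
    (h1 : HypH1 F) (h2 : HypH2' F) (h3 : HypH3 F 0 C₃ C₄ C₅)
    (R Λ K η : ℝ) (hR : 0 ≤ R) (hK : 0 ≤ K) (hη : 0 < η) :
    ∃ ρ > 0, ∀ (px qx : Euc n) (py qy lam mu : ℝ) (u v : Dom n → ℝ),
      |py| ≤ R → lam ≤ Λ → Bdd u → Bdd v → STPeriodic u → STPeriodic v →
      ViscSub (fun x y t rx ry => F x y t (px + rx) (py + ry)) 0 lam u →
      ViscSuper (fun x y t rx ry => F x y t (qx + rx) (qy + ry)) 0 mu v →
      ((∀ z w, u z - u w ≤ K) ∨ (∀ z w, v z - v w ≤ K)) →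
      ‖qx - px‖ < ρ → |qy - py| < ρ → mu ≤ lam + η := by
  obtain ⟨C0, hC0, hlow⟩ := lower_F h1 h3 h2
  have hC3 : 0 ≤ C₃ := h3.1
  have hC4 : 0 ≤ C₄ := h3.2.1
  have hC5 : 0 ≤ C₅ := h3.2.2.1
  have hnn : (0 : ℝ) ≤ n := Nat.cast_nonneg n
  set C : ℝ := 1 + C₃ * (R + 2) + 2 * C₄ * (1 + (1 + C₅) * (R + 1) + |Λ| + C0 + 2) with hC
  have hCpos : 0 < C := by positivity
  obtain ⟨δ, hδ, hδ1, hδ4, hδη⟩ : ∃ δ : ℝ, 0 < δ ∧ δ ≤ 1 ∧ C₄ * δ ≤ 1 / 2 ∧ C * δ ≤ η := by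
    refine ⟨min 1 (min (1 / (2 * (C₄ + 1))) (η / C)), by positivity, min_le_left _ _, ?_, ?_⟩
    · have : min 1 (min (1 / (2 * (C₄ + 1))) (η / C)) ≤ 1 / (2 * (C₄ + 1)) :=
        (min_le_right _ _).trans (min_le_left _ _)
      calc _ ≤ C₄ * (1 / (2 * (C₄ + 1))) := by gcongr
        _ ≤ 1 / 2 := by
          rw [mul_one_div, div_le_div_iff₀ (by positivity) (by positivity)]; linarith
    · have : min 1 (min (1 / (2 * (C₄ + 1))) (η / C)) ≤ η / C :=
        (min_le_right _ _).trans (min_le_right _ _)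
      calc _ ≤ C * (η / C) := by gcongr
        _ = η := by field_simp
  set ε := δ * Real.exp (-(K / (2 * δ))) with hεdef
  have hε : 0 < ε := by positivity
  have hεK : ε ^ 2 * Real.exp (K / δ) = δ ^ 2 := by
    rw [hεdef, mul_pow, ← Real.exp_nat_mul, mul_assoc, ← Real.exp_add]
    have : ((2 : ℕ) : ℝ) * -(K / (2 * δ)) + K / δ = 0 := by push_cast; field_simp; ring
    rw [this, Real.exp_zero, mul_one]
  set R' := R + δ / ε with hR'
  have hde : 0 < δ / ε := by positivity
  obtain ⟨C₁, C₂, hC1, hC2, hco⟩ := h2 R' (by positivity)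
  set L := (|Λ| + δ / ε + C₂) / C₁ with hL
  have hL0 : 0 ≤ L := by positivity
  set B : ℝ := n + 2 + L + 1 + R' + 1 with hB
  have hR'0 : 0 ≤ R' := by positivity
  have huc := (isCompact_closedBall (0 : Xi n) B).uniformContinuousOn_of_continuous
    h1.1.continuousOn
  obtain ⟨ρ₀, hρ₀, hρF⟩ := Metric.uniformContinuousOn_iff.1 huc δ hδ
  set ρ := min ρ₀ 1 with hρ
  have hρpos : 0 < ρ := by positivity
  refine ⟨ρ, hρpos, ?_⟩
  intro px qx py qy lam mu u v hpy hlam hub hvb hup hvp hu hv hosc hqx hqy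
  set N := (K + 1) / ρ ^ 2 with hN
  have hN0 : 0 < N := by positivity
  obtain ⟨z, z', hz, hmax⟩ := exists_max_s15 hδ hε hN0 hub hvb hup hvp hu.1 hv.1
  have hpen : pen δ ε N (z - z') ≤ K := by
    rcases hosc with ho | ho
    · have := hmax z' z'
      rw [sub_self, pen_zero] at this
      linarith [ho z z']
    · have := hmax z z
      rw [sub_self, pen_zero] at this
      linarith [ho z z']
  have hsub := hu.2 (fun w => pen δ ε N (w - z')) 
    ((pen_contDiff hε).comp (contDiff_id.sub contDiff_const)) z
    (Filter.Eventually.of_forall fun w => by linarith [hmax w z'])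
  have hsup := hv.2 (fun w => - pen δ ε N (z - w)) 
    ((pen_contDiff hε).comp (contDiff_const.sub contDiff_id)).neg z'
    (Filter.Eventually.of_forall fun w => by linarith [hmax z w])
  have hd1 : HasFDerivAt (fun w => pen δ ε N (w - z')) (penD δ ε N (z - z')) z := by
    have := (pen_hasFDerivAt (δ := δ) (N := N) hε (z - z')).comp z
      ((hasFDerivAt_id z).sub_const z')
    exact this
  have hd2 : HasFDerivAt (fun w => - pen δ ε N (z - w)) (penD δ ε N (z - z')) z' := by
    have := ((pen_hasFDerivAt (δ := δ) (N := N) hε (z - z')).comp z'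
      ((hasFDerivAt_id z').const_sub z)).neg
    refine this.congr_fderiv ?_
    ext <;> simp
  obtain ⟨e1, e2, e3⟩ := pd_of_penD hd1
  obtain ⟨f1, f2, f3⟩ := pd_of_penD hd2
  rw [e1, e2, e3, zero_mul, add_zero] at hsub
  rw [f1, f2, f3, zero_mul, add_zero] at hsup
  obtain ⟨hbc, ha⟩ := pen_le hδ hε hN0 hpen
  rw [hεK] at hbc
  obtain ⟨x, y, t⟩ := z
  obtain ⟨x', y', t'⟩ := z'
  simp only [Prod.mk_sub_mk] at hsub hsup hbc ha
  set b := y - y' with hb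
  set c := t - t' with hc
  have hbδ : |b| ≤ δ := abs_le_of_sq_le_sq (by nlinarith [sq_nonneg c]) hδ.le
  have hcδ : |c| ≤ δ := abs_le_of_sq_le_sq (by nlinarith [sq_nonneg b]) hδ.le
  have haρ : ‖x - x'‖ < ρ := by
    refine lt_of_pow_lt_pow_left₀ 2 hρpos.le (ha.trans_lt ?_)
    rw [hN, div_div_eq_mul_div, div_lt_iff₀ (by positivity)]
    nlinarith [pow_pos hρpos 2]
  obtain ⟨g1, g2, g3⟩ := pen_real hδ hε b c
  obtain ⟨k1, k2, k3⟩ := pen_real hδ hε c b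
  rw [add_right_comm (ε ^ 2) (c ^ 2) (b ^ 2)] at k1 k2 k3
  set gy := 2 * δ / (ε ^ 2 + b ^ 2 + c ^ 2) * b with hgy
  set gt := 2 * δ / (ε ^ 2 + b ^ 2 + c ^ 2) * c with hgt
  set gx : Euc n := (2 * N) • (x - x') with hgx
  set Py := py + gy with hPy
  set Px := px + gx with hPx
  have hPyle : |Py| ≤ R + |gy| := (abs_add_le _ _).trans (by linarith)
  have hPyR : |Py| ≤ R' := hPyle.trans (by linarith)
  have hgt := abs_le.1 k1
  have hPxL : ‖Px‖ ≤ L := by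
    rw [hL, le_div_iff₀ hC1]
    have := hco x y t Px Py hPyR
    linarith [le_abs_self Λ]
  have hD1 : F x' y' t' (qx + gx) (qy + gy) - F x y' t' Px Py < δ := by
    have hzx : ‖x‖ ≤ n + 1 := (norm_prod_le_iff.1 hz).1
    have hzy : |y| ≤ n + 1 := (norm_prod_le_iff.1 (norm_prod_le_iff.1 hz).2).1
    have hzt : |t| ≤ n + 1 := (norm_prod_le_iff.1 (norm_prod_le_iff.1 hz).2).2
    have hρ1 : ρ ≤ 1 := min_le_right _ _
    have hx' : ‖x'‖ ≤ n + 2 := by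
      have : ‖x'‖ ≤ ‖x‖ + ‖x - x'‖ := by
        have := norm_sub_le x (x - x'); rwa [sub_sub_cancel] at this
      linarith
    have hy' : |y'| ≤ n + 2 := by
      have e : y' = y - b := by rw [hb]; ring
      rw [e]; linarith [abs_sub y b]
    have ht' : |t'| ≤ n + 2 := by
      have e : t' = t - c := by rw [hc]; ring
      rw [e]; linarith [abs_sub t c]
    have hqxL : ‖qx + gx‖ ≤ L + 1 := by
      have e : qx + gx = Px + (qx - px) := by rw [hPx]; abel
      rw [e]; exact (norm_add_le _ _).trans (by linarith)
    have hqyL : |qy + gy| ≤ R' + 1 := by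
      have e : qy + gy = Py + (qy - py) := by rw [hPy]; ring
      rw [e]; exact (abs_add_le _ _).trans (by linarith)
    have m1 : ((x', y', t', qx + gx, qy + gy) : Xi n) ∈ Metric.closedBall (0 : Xi n) B := by
      rw [mem_closedBall_zero_iff]
      simp only [norm_prod_le_iff, Real.norm_eq_abs]
      refine ⟨?_, ?_, ?_, ?_, ?_⟩ <;> linarith
    have m2 : ((x, y', t', Px, Py) : Xi n) ∈ Metric.closedBall (0 : Xi n) B := by
      rw [mem_closedBall_zero_iff]
      simp only [norm_prod_le_iff, Real.norm_eq_abs]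
      refine ⟨?_, ?_, ?_, ?_, ?_⟩ <;> linarith
    have hdist : dist ((x', y', t', qx + gx, qy + gy) : Xi n) (x, y', t', Px, Py) < ρ₀ := by
      refine lt_of_lt_of_le ?_ (min_le_left ρ₀ 1)
      simp only [Prod.dist_eq, dist_self, max_lt_iff]
      refine ⟨?_, hρpos, hρpos, ?_, ?_⟩
      · rw [dist_comm, dist_eq_norm]; exact haρ
      · rw [hPx, dist_add_right, dist_eq_norm]; exact hqx
      · rw [hPy, dist_add_right, Real.dist_eq]; exact hqy
    have := hρF _ m1 _ m2 hdist
    rw [Real.dist_eq] at this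
    exact (le_abs_self _).trans_lt this
  have hD2 : F x y' t' Px Py - F x y t' Px Py ≤ C₃ * (R + 2) * δ := by
    have h := (le_abs_self _).trans (bound_y' h1 h3 x t' Px Py y y')
    rw [abs_sub_comm y' y, mul_assoc] at h
    have : |Py| * |b| ≤ (R + 2) * δ := by
      calc |Py| * |b| ≤ (R + |gy|) * |b| := by gcongr
        _ = R * |b| + |gy| * |b| := by ring
        _ ≤ R * δ + 2 * δ := by gcongr
        _ = _ := by ring
    calc _ ≤ _ := h
      _ ≤ C₃ * ((R + 2) * δ) := by gcongr
      _ = _ := by ring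
  have hD3 : F x y t' Px Py - F x y t Px Py ≤
      2 * C₄ * (1 + (1 + C₅) * (R + 1) + |Λ| + C0 + 2) * δ := by
    have hs : C₄ * |t' - t| ≤ 1 / 2 := by
      rw [abs_sub_comm]; exact (mul_le_mul_of_nonneg_left hcδ hC4).trans hδ4
    have h := (le_abs_self _).trans (bound_t' h1 h3 x y Px Py t t' hs)
    rw [abs_sub_comm t' t] at h
    have hF : |F x y t Px Py| ≤ |Λ| + |gt| + C0 + C₅ * |Py| := by
      have hl := hlow x y t Px Py
      have : 0 ≤ C₅ * |Py| := by positivity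
      rw [abs_le]
      constructor
      · linarith [abs_nonneg Λ, abs_nonneg gt]
      · linarith [le_abs_self Λ, neg_abs_le gt]
    have hPc : |c| * |Py| ≤ (R + 1) * δ := by
      calc |c| * |Py| ≤ |c| * (R + |gy|) := by gcongr
        _ = R * |c| + |gy| * |c| := by ring
        _ ≤ R * δ + δ := by gcongr
        _ = _ := by ring
    have hfin : |c| * (1 + |Py| + |F x y t Px Py|) ≤
        (1 + (1 + C₅) * (R + 1) + |Λ| + C0 + 2) * δ := by
      calc |c| * (1 + |Py| + |F x y t Px Py|)
          ≤ |c| * (1 + |Py| + (|Λ| + |gt| + C0 + C₅ * |Py|)) := by gcongr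
        _ = |c| * (1 + |Λ| + C0) + (1 + C₅) * (|c| * |Py|) + |gt| * |c| := by ring
        _ ≤ δ * (1 + |Λ| + C0) + (1 + C₅) * ((R + 1) * δ) + 2 * δ := by gcongr
        _ = _ := by ring
    calc _ ≤ _ := h
      _ = 2 * C₄ * (|c| * (1 + |Py| + |F x y t Px Py|)) := by ring
      _ ≤ 2 * C₄ * ((1 + (1 + C₅) * (R + 1) + |Λ| + C0 + 2) * δ) := by gcongr
      _ = _ := by ring
  have hCe : C * δ = δ + C₃ * (R + 2) * δ +
      2 * C₄ * (1 + (1 + C₅) * (R + 1) + |Λ| + C0 + 2) * δ := by rw [hC]; ring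
  linarith

/-- If F satisfies (H1), (H2') and (H3) with l = 0, then the
homogenized Hamiltonian F̄ is continuous on ℝⁿ×ℝ. -/
theorem statement15 {n : ℕ} (hn : 0 < n) (F : Ham n) (C₃ C₄ C₅ : ℝ)
    (h1 : HypH1 F) (h2 : HypH2' F) (h3 : HypH3 F 0 C₃ C₄ C₅)
    (Fbar : Euc n × ℝ → ℝ)
    (hFbar : ∀ (px : Euc n) (py : ℝ), CellOk F px py (Fbar (px, py))) :
    Continuous Fbar := by
  rw [continuous_iff_continuousAt]
  rintro ⟨qx, qy⟩
  rw [Metric.continuousAt_iff]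
  intro η hη
  obtain ⟨⟨u, ⟨Mu, hMu⟩, hup, hu⟩, ⟨v, ⟨Mv, hMv⟩, hvp, hv⟩⟩ := hFbar qx qy
  have hMu0 : 0 ≤ Mu := (abs_nonneg _).trans (hMu 0)
  have hMv0 : 0 ≤ Mv := (abs_nonneg _).trans (hMv 0)
  obtain ⟨ρ, hρ, H⟩ := comparison_s15 h1 h2 h3 (|qy| + 1) (Fbar (qx, qy)) (2 * Mu + 2 * Mv) (η / 2)
    (by positivity) (by positivity) (by positivity)
  refine ⟨min ρ 1, by positivity, ?_⟩
  rintro ⟨px, py⟩ hd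
  rw [lt_min_iff, Prod.dist_eq, max_lt_iff, max_lt_iff] at hd
  obtain ⟨⟨hx, hy⟩, -, hy1⟩ := hd
  simp only [dist_eq_norm, Real.norm_eq_abs] at hx hy hy1
  obtain ⟨⟨u', hu'b, hup', hu'⟩, ⟨v', hv'b, hvp', hv'⟩⟩ := hFbar px py
  have hyR : |py| ≤ |qy| + 1 := by
    have := abs_sub_abs_le_abs_sub py qy; linarith
  have hou : ∀ z w, u z - u w ≤ 2 * Mu + 2 * Mv := fun z w => by
    linarith [(abs_le.1 (hMu z)).2, (abs_le.1 (hMu w)).1]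
  have hov : ∀ z w, v z - v w ≤ 2 * Mu + 2 * Mv := fun z w => by
    linarith [(abs_le.1 (hMv z)).2, (abs_le.1 (hMv w)).1]
  have A := H qx px qy py (Fbar (qx, qy)) (Fbar (px, py)) u v' (by linarith) le_rfl ⟨Mu, hMu⟩
    hv'b hup hvp' hu hv' (Or.inl hou) hx hy
  have B' : Fbar (qx, qy) ≤ Fbar (px, py) + η / 2 := by
    by_contra hcon
    push Not at hcon
    have := H px qx py qy (Fbar (px, py)) (Fbar (qx, qy)) u' v hyR (by linarith) hu'b
      ⟨Mv, hMv⟩ hup' hvp hu' hv (Or.inr hov) (by rwa [norm_sub_rev]) (by rwa [abs_sub_comm])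
    linarith
  rw [Real.dist_eq, abs_lt]
  constructor <;> linarith
end
end
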